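/- arXiv:1310.5071 — 3 statements merged into one kernel-verified Lean document; each statement's English description precedes it below -/
import Mathlib

section
/- The fixed ring D^ρ = {r ∈ D : ρ(r) = r} is isomorphic to D = k_q(x,y) as a k-algebra (for the same q). -/
/-- `D`, together with the distinguished nonzero elements `x`, `y` satisfying
`x * y = q • (y * x)`, is the `q`-division ring `k_q(x,y)`: the Ore division ring of fractions
of the quantum plane `k_q[x,y]`.  The quantum plane sits inside `D` as the `k`-subalgebra
generated by `x` and `y`; linear independence of the monomials `yⁱxʲ` says that this subalgebra
really is the quantum plane, and `exists_frac` says that `D` is its ring of (left) fractions. -/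
structure IsQDivisionRing (k : Type*) [Field k] (D : Type*) [DivisionRing D] [Algebra k D]
    (q : k) (x y : D) : Prop where
  x_ne_zero : x ≠ 0
  y_ne_zero : y ≠ 0
  rel : x * y = algebraMap k D q * (y * x)
  monomials_linearIndependent :
    LinearIndependent k fun p : ℕ × ℕ => y ^ p.1 * x ^ p.2
  exists_frac : ∀ d : D, ∃ s t : D, s ∈ Algebra.adjoin k ({x, y} : Set D) ∧
    t ∈ Algebra.adjoin k ({x, y} : Set D) ∧ t ≠ 0 ∧ d = t⁻¹ * s

section QCommuting

variable {k E : Type*} [Field k] [Ring E] [Algebra k E] {q : k} {X Y : E}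

theorem pow_mul_pow_of_mul_eq_smul (h : X * Y = q • (Y * X)) (i j : ℕ) :
    X ^ j * Y ^ i = q ^ (j * i) • (Y ^ i * X ^ j) := by
  have h1 : ∀ i : ℕ, X * Y ^ i = q ^ i • (Y ^ i * X) := by
    intro i
    induction i with
    | zero => simp
    | succ i ih =>
      rw [pow_succ, ← mul_assoc, ih, smul_mul_assoc, mul_assoc, h, mul_smul_comm, smul_smul,
        ← pow_succ, ← mul_assoc]
  induction j with
  | zero => simp
  | succ j ih =>
    rw [pow_succ, mul_assoc, h1, mul_smul_comm, ← mul_assoc, ih, smul_mul_assoc, smul_smul,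
      ← pow_add, mul_assoc, add_mul, one_mul, add_comm]

theorem monomial_mul_monomial_of_mul_eq_smul (h : X * Y = q • (Y * X)) (p p' : ℕ × ℕ) :
    Y ^ p.1 * X ^ p.2 * (Y ^ p'.1 * X ^ p'.2) =
      q ^ (p.2 * p'.1) • (Y ^ (p + p').1 * X ^ (p + p').2) := by
  have e : Y ^ p.1 * X ^ p.2 * (Y ^ p'.1 * X ^ p'.2) =
      Y ^ p.1 * (X ^ p.2 * Y ^ p'.1) * X ^ p'.2 := by simp only [mul_assoc]
  rw [e, pow_mul_pow_of_mul_eq_smul h, mul_smul_comm, smul_mul_assoc, Prod.fst_add, Prod.snd_add,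
    pow_add, pow_add]
  simp only [mul_assoc]

theorem mem_span_monomials_of_mem_adjoin (h : X * Y = q • (Y * X)) {a : E}
    (ha : a ∈ Algebra.adjoin k ({X, Y} : Set E)) :
    a ∈ Submodule.span k (Set.range fun p : ℕ × ℕ => Y ^ p.1 * X ^ p.2) := by
  induction ha using Algebra.adjoin_induction with
  | mem a ha =>
    rcases ha with rfl | rfl
    · exact Submodule.subset_span ⟨(0, 1), by simp⟩
    · exact Submodule.subset_span ⟨(1, 0), by simp⟩
  | algebraMap c =>
    rw [Algebra.algebraMap_eq_smul_one]
    exact Submodule.smul_mem _ _ (Submodule.subset_span ⟨(0, 0), by simp⟩)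
  | add a b _ _ iha ihb => exact Submodule.add_mem _ iha ihb
  | mul a b _ _ iha ihb =>
    refine Submodule.mul_le.1 ?_ a iha b ihb
    rw [Submodule.span_mul_span, Submodule.span_le]
    rintro _ ⟨_, ⟨p, rfl⟩, _, ⟨p', rfl⟩, rfl⟩
    simp only [monomial_mul_monomial_of_mul_eq_smul h]
    exact Submodule.smul_mem _ _ (Submodule.subset_span ⟨p + p', rfl⟩)

end QCommuting

namespace IsQDivisionRing

section Basic

variable {k D : Type*} [Field k] [DivisionRing D] [Algebra k D] {q : k} {x y : D}

theorem mul_eq_smul (hD : IsQDivisionRing k D q x y) : x * y = q • (y * x) := by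
  rw [hD.rel, Algebra.smul_def]

theorem exists_ore (hD : IsQDivisionRing k D q x y) (s : D) {t : D} (ht0 : t ≠ 0) :
    ∃ a b : D, a ∈ Algebra.adjoin k ({x, y} : Set D) ∧
      b ∈ Algebra.adjoin k ({x, y} : Set D) ∧ b ≠ 0 ∧ b * s = a * t := by
  obtain ⟨a, b, ha, hb, hb0, h⟩ := hD.exists_frac (s * t⁻¹)
  refine ⟨a, b, ha, hb, hb0, ?_⟩
  have h2 := congrArg (fun d => b * d * t) h
  simpa [mul_assoc, hb0, ht0] using h2

theorem exists_common_denom (hD : IsQDivisionRing k D q x y) (d e : D) :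
    ∃ t : D, t ∈ Algebra.adjoin k ({x, y} : Set D) ∧ t ≠ 0 ∧
      t * d ∈ Algebra.adjoin k ({x, y} : Set D) ∧ t * e ∈ Algebra.adjoin k ({x, y} : Set D) := by
  obtain ⟨s, t, hs, ht, ht0, rfl⟩ := hD.exists_frac d
  obtain ⟨s', t', hs', ht', ht0', rfl⟩ := hD.exists_frac e
  obtain ⟨a, b, ha, hb, hb0, h⟩ := hD.exists_ore t ht0'
  refine ⟨b * t, mul_mem hb ht, mul_ne_zero hb0 ht0, ?_, ?_⟩
  · rw [mul_assoc, mul_inv_cancel_left₀ ht0]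
    exact mul_mem hb hs
  · rw [h, mul_assoc, mul_inv_cancel_left₀ ht0']
    exact mul_mem ha hs'

theorem exists_chain_denom (hD : IsQDivisionRing k D q x y) (d e : D) :
    ∃ t : D, t ∈ Algebra.adjoin k ({x, y} : Set D) ∧ t ≠ 0 ∧
      t * d ∈ Algebra.adjoin k ({x, y} : Set D) ∧
      t * d * e ∈ Algebra.adjoin k ({x, y} : Set D) := by
  obtain ⟨t, ht, ht0, h1, h2⟩ := hD.exists_common_denom d (d * e)
  exact ⟨t, ht, ht0, h1, by rwa [mul_assoc]⟩

theorem algHom_ext (hD : IsQDivisionRing k D q x y) {E : Type*} [DivisionRing E] [Algebra k E]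
    {f g : D →ₐ[k] E}
    (hx : f x = g x) (hy : f y = g y) : f = g := by
  have key : ∀ a ∈ Algebra.adjoin k ({x, y} : Set D), f a = g a := by
    intro a ha
    induction ha using Algebra.adjoin_induction with
    | mem a ha => rcases ha with rfl | rfl <;> assumption
    | algebraMap c => simp
    | add a b _ _ iha ihb => rw [map_add, map_add, iha, ihb]
    | mul a b _ _ iha ihb => rw [map_mul, map_mul, iha, ihb]
  ext d
  obtain ⟨s, t, hs, ht, -, rfl⟩ := hD.exists_frac d
  rw [map_mul, map_mul, map_inv₀, map_inv₀, key s hs, key t ht]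

end Basic

section Lift

variable {k D E : Type*} [Field k] [DivisionRing D] [Algebra k D] [DivisionRing E] [Algebra k E]
  {q : k} {x y : D} {u v : E}

/-- The graph of the homomorphism from the quantum plane sending `x` to `u` and `y` to `v`. -/
def planeGraph (k : Type*) {D E : Type*} [Field k] [DivisionRing D] [Algebra k D]
    [DivisionRing E] [Algebra k E] (x y : D) (u v : E) : Subalgebra k (D × E) :=
  Algebra.adjoin k {(x, u), (y, v)}

theorem map_fst_planeGraph :
    (planeGraph k x y u v).map (AlgHom.fst k D E) = Algebra.adjoin k ({x, y} : Set D) := by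
  rw [planeGraph, AlgHom.map_adjoin, Set.image_pair]
  rfl

theorem exists_mem_planeGraph {s : D} (hs : s ∈ Algebra.adjoin k ({x, y} : Set D)) :
    ∃ s' : E, (s, s') ∈ planeGraph k x y u v := by
  rw [← map_fst_planeGraph (u := u) (v := v)] at hs
  obtain ⟨⟨a, b⟩, hab, rfl⟩ := hs
  exact ⟨b, hab⟩

theorem mem_adjoin_of_mem_planeGraph {s : D} {s' : E} (h : (s, s') ∈ planeGraph k x y u v) :
    s ∈ Algebra.adjoin k ({x, y} : Set D) := by
  rw [← map_fst_planeGraph (u := u) (v := v)]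
  exact ⟨_, h, rfl⟩

theorem planeGraph_eq_zero_iff (hD : IsQDivisionRing k D q x y) (huv : u * v = q • (v * u))
    (hli : LinearIndependent k fun p : ℕ × ℕ => v ^ p.1 * u ^ p.2) {s : D} {s' : E}
    (hs : (s, s') ∈ planeGraph k x y u v) : s = 0 ↔ s' = 0 := by
  have hrel : ((x, u) * (y, v) : D × E) = q • ((y, v) * (x, u)) :=
    Prod.ext hD.mul_eq_smul huv
  obtain ⟨l, hl⟩ := Finsupp.mem_span_range_iff_exists_finsupp.1
    (mem_span_monomials_of_mem_adjoin hrel hs)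
  have h1 : Finsupp.linearCombination k (fun p : ℕ × ℕ => y ^ p.1 * x ^ p.2) l = s := by
    have := congrArg (AlgHom.fst k D E) hl
    simpa [Finsupp.sum, Finsupp.linearCombination_apply, Prod.fst_sum] using this
  have h2 : Finsupp.linearCombination k (fun p : ℕ × ℕ => v ^ p.1 * u ^ p.2) l = s' := by
    have := congrArg (AlgHom.snd k D E) hl
    simpa [Finsupp.sum, Finsupp.linearCombination_apply, Prod.snd_sum] using this
  constructor
  · rintro rfl
    have := linearIndependent_iff.1 hD.monomials_linearIndependent l h1
    rw [← h2, this, map_zero]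
  · rintro rfl
    have := linearIndependent_iff.1 hli l h2
    rw [← h1, this, map_zero]

/-- The graph of the extension of the homomorphism `x ↦ u`, `y ↦ v` to the ring of fractions. -/
def FracGraph (k : Type*) {D E : Type*} [Field k] [DivisionRing D] [Algebra k D]
    [DivisionRing E] [Algebra k E] (x y : D) (u v : E) (d : D) (e : E) : Prop :=
  ∃ t t', (t, t') ∈ planeGraph k x y u v ∧ t ≠ 0 ∧ (t * d, t' * e) ∈ planeGraph k x y u v

variable (hD : IsQDivisionRing k D q x y) (huv : u * v = q • (v * u))
  (hli : LinearIndependent k fun p : ℕ × ℕ => v ^ p.1 * u ^ p.2)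

include hD huv hli

theorem planeGraph_unique {s : D} {s₁ s₂ : E} (h₁ : (s, s₁) ∈ planeGraph k x y u v)
    (h₂ : (s, s₂) ∈ planeGraph k x y u v) : s₁ = s₂ := by
  have := sub_mem h₁ h₂
  rw [Prod.mk_sub_mk] at this
  exact sub_eq_zero.1 ((planeGraph_eq_zero_iff hD huv hli this).1 (sub_self s))

theorem FracGraph.mem_of_mem {d : D} {e : E} (h : FracGraph k x y u v d e) {t : D} {t' : E}
    (ht : (t, t') ∈ planeGraph k x y u v)
    (htd : t * d ∈ Algebra.adjoin k ({x, y} : Set D)) :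
    (t * d, t' * e) ∈ planeGraph k x y u v := by
  obtain ⟨p, p', hp, hp0, hpd⟩ := h
  rcases eq_or_ne t 0 with rfl | ht0
  · obtain rfl := (planeGraph_eq_zero_iff hD huv hli ht).1 rfl
    rw [zero_mul, zero_mul]
    exact zero_mem (planeGraph k x y u v)
  obtain ⟨a, b, ha, hb, hb0, hab⟩ := hD.exists_ore p ht0
  obtain ⟨a', ha'⟩ := exists_mem_planeGraph (u := u) (v := v) ha
  obtain ⟨b', hb'⟩ := exists_mem_planeGraph (u := u) (v := v) hb
  obtain ⟨w, hw⟩ := exists_mem_planeGraph (u := u) (v := v) htd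
  have ha0 : a ≠ 0 := by
    rintro rfl
    rw [zero_mul] at hab
    exact mul_ne_zero hb0 hp0 hab
  have ha0' : a' ≠ 0 := fun h => ha0 ((planeGraph_eq_zero_iff hD huv hli ha').2 h)
  have e1 : b' * p' = a' * t' :=
    planeGraph_unique hD huv hli (mul_mem hb' hp)
      (by
        change (b * p, a' * t') ∈ _
        rw [hab]
        exact mul_mem ha' ht)
  have e2 : a' * w = b' * (p' * e) :=
    planeGraph_unique hD huv hli (mul_mem ha' hw)
      (by
        have h3 : a * (t * d) = b * (p * d) := by rw [← mul_assoc, ← hab, mul_assoc]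
        change (a * (t * d), b' * (p' * e)) ∈ _
        rw [h3]
        exact mul_mem hb' hpd)
  rw [← mul_assoc, e1, mul_assoc] at e2
  rwa [← mul_left_cancel₀ ha0' e2]

theorem FracGraph.unique {d : D} {e₁ e₂ : E} (h₁ : FracGraph k x y u v d e₁)
    (h₂ : FracGraph k x y u v d e₂) : e₁ = e₂ := by
  obtain ⟨t, t', ht, ht0, htd⟩ := h₁
  have h := h₂.mem_of_mem hD huv hli ht (mem_adjoin_of_mem_planeGraph htd)
  have ht0' : t' ≠ 0 := fun h => ht0 ((planeGraph_eq_zero_iff hD huv hli ht).2 h)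
  exact mul_left_cancel₀ ht0' (planeGraph_unique hD huv hli htd h)

theorem exists_fracGraph (d : D) : ∃ e : E, FracGraph k x y u v d e := by
  obtain ⟨s, t, hs, ht, ht0, rfl⟩ := hD.exists_frac d
  obtain ⟨s', hs'⟩ := exists_mem_planeGraph (u := u) (v := v) hs
  obtain ⟨t', ht'⟩ := exists_mem_planeGraph (u := u) (v := v) ht
  have ht0' : t' ≠ 0 := fun h => ht0 ((planeGraph_eq_zero_iff hD huv hli ht').2 h)
  refine ⟨t'⁻¹ * s', t, t', ht', ht0, ?_⟩
  rwa [mul_inv_cancel_left₀ ht0, mul_inv_cancel_left₀ ht0']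

theorem FracGraph.add {d₁ d₂ : D} {e₁ e₂ : E} (h₁ : FracGraph k x y u v d₁ e₁)
    (h₂ : FracGraph k x y u v d₂ e₂) : FracGraph k x y u v (d₁ + d₂) (e₁ + e₂) := by
  obtain ⟨t, ht, ht0, htd₁, htd₂⟩ := hD.exists_common_denom d₁ d₂
  obtain ⟨t', ht'⟩ := exists_mem_planeGraph (u := u) (v := v) ht
  refine ⟨t, t', ht', ht0, ?_⟩
  rw [mul_add, mul_add]
  exact add_mem (h₁.mem_of_mem hD huv hli ht' htd₁) (h₂.mem_of_mem hD huv hli ht' htd₂)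

theorem FracGraph.mul {d₁ d₂ : D} {e₁ e₂ : E} (h₁ : FracGraph k x y u v d₁ e₁)
    (h₂ : FracGraph k x y u v d₂ e₂) : FracGraph k x y u v (d₁ * d₂) (e₁ * e₂) := by
  obtain ⟨t, ht, ht0, htd₁, htd₂⟩ := hD.exists_chain_denom d₁ d₂
  obtain ⟨t', ht'⟩ := exists_mem_planeGraph (u := u) (v := v) ht
  refine ⟨t, t', ht', ht0, ?_⟩
  rw [← mul_assoc, ← mul_assoc]
  exact h₂.mem_of_mem hD huv hli (h₁.mem_of_mem hD huv hli ht' htd₁) htd₂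

/-- The universal property of the `q`-division ring: `x` and `y` can be sent to any two
`q`-commuting elements whose monomials are linearly independent. -/
theorem exists_algHom : ∃ F : D →ₐ[k] E, F x = u ∧ F y = v := by
  choose f hf using exists_fracGraph hD huv hli
  have heq : ∀ {d e}, FracGraph k x y u v d e → f d = e := fun h =>
    (hf _).unique hD huv hli h
  have hmem : ∀ {d e}, (d, e) ∈ planeGraph k x y u v → f d = e := fun {d e} h =>
    heq ⟨1, 1, one_mem _, one_ne_zero, by simpa using h⟩
  refine ⟨{ toFun := f
            map_one' := hmem (one_mem _)
            map_zero' := hmem (zero_mem _)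
            map_add' := fun a b => heq ((hf a).add hD huv hli (hf b))
            map_mul' := fun a b => heq ((hf a).mul hD huv hli (hf b))
            commutes' := fun c => hmem ((planeGraph k x y u v).algebraMap_mem c) }, ?_, ?_⟩
  · exact hmem (Algebra.subset_adjoin (by simp))
  · exact hmem (Algebra.subset_adjoin (by simp))

end Lift

end IsQDivisionRing

namespace IsQDivisionRing

section Leading

variable {k D : Type*} [Field k] [DivisionRing D] [Algebra k D] {q : k} {x y : D}

/-- The degree of the monomial `yⁱxʲ`; degrees are compared lexicographically. -/
def lexDegree (p : ℕ × ℕ) : ℤ ×ₗ ℤ := toLex ((p.1 : ℤ), (p.2 : ℤ))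

theorem lexDegree_add (p p' : ℕ × ℕ) : lexDegree (p + p') = lexDegree p + lexDegree p' := by
  simp only [lexDegree, Prod.fst_add, Prod.snd_add, Nat.cast_add, ← toLex_add, Prod.mk_add_mk]

theorem lexDegree_injective : Function.Injective lexDegree := by
  rintro ⟨a, b⟩ ⟨c, d⟩ h
  simpa [lexDegree] using h

/-- The span of the monomials of degree less than `γ`. -/
def lowerTerms (k : Type*) {D : Type*} [Field k] [DivisionRing D] [Algebra k D] (x y : D)
    (γ : ℤ ×ₗ ℤ) : Submodule k D :=
  Submodule.span k ((fun p : ℕ × ℕ => y ^ p.1 * x ^ p.2) '' {p | lexDegree p < γ})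

/-- `s` is a quantum polynomial with leading monomial `yⁱxʲ`, where `p = (i, j)`. -/
def HasLead (k : Type*) {D : Type*} [Field k] [DivisionRing D] [Algebra k D] (x y : D)
    (s : D) (p : ℕ × ℕ) : Prop :=
  ∃ c : k, c ≠ 0 ∧ s - c • (y ^ p.1 * x ^ p.2) ∈ lowerTerms k x y (lexDegree p)

theorem lowerTerms_mono {γ δ : ℤ ×ₗ ℤ} (h : γ ≤ δ) :
    lowerTerms k x y γ ≤ lowerTerms k x y δ :=
  Submodule.span_mono (Set.image_mono fun _ hp => lt_of_lt_of_le hp h)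

theorem monomial_mem_lowerTerms {p : ℕ × ℕ} {γ : ℤ ×ₗ ℤ} (h : lexDegree p < γ) :
    y ^ p.1 * x ^ p.2 ∈ lowerTerms k x y γ :=
  Submodule.subset_span ⟨p, h, rfl⟩

theorem HasLead.mem_lowerTerms {s : D} {p : ℕ × ℕ} (h : HasLead k x y s p) {γ : ℤ ×ₗ ℤ}
    (hp : lexDegree p < γ) : s ∈ lowerTerms k x y γ := by
  obtain ⟨c, -, hs⟩ := h
  rw [← sub_add_cancel s (c • (y ^ p.1 * x ^ p.2))]
  exact add_mem (lowerTerms_mono hp.le hs)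
    (Submodule.smul_mem _ _ (monomial_mem_lowerTerms hp))

theorem HasLead.add_of_mem {s s' : D} {p : ℕ × ℕ} (h : HasLead k x y s p)
    (h' : s' ∈ lowerTerms k x y (lexDegree p)) : HasLead k x y (s' + s) p := by
  obtain ⟨c, hc, hs⟩ := h
  refine ⟨c, hc, ?_⟩
  rw [add_sub_assoc]
  exact add_mem h' hs

theorem hasLead_monomial (p : ℕ × ℕ) : HasLead k x y (y ^ p.1 * x ^ p.2) p :=
  ⟨1, one_ne_zero, by simp⟩

theorem HasLead.not_mem (hD : IsQDivisionRing k D q x y) {s : D} {p : ℕ × ℕ}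
    (h : HasLead k x y s p) : s ∉ lowerTerms k x y (lexDegree p) := by
  obtain ⟨c, hc, hs⟩ := h
  intro h'
  have h1 : c • (y ^ p.1 * x ^ p.2) ∈ lowerTerms k x y (lexDegree p) := by
    simpa using sub_mem h' hs
  have h2 := Submodule.smul_mem _ c⁻¹ h1
  rw [smul_smul, inv_mul_cancel₀ hc, one_smul] at h2
  exact hD.monomials_linearIndependent.notMem_span_image (x := p)
    (s := {p' | lexDegree p' < lexDegree p}) (by simp) h2

theorem HasLead.ne_zero (hD : IsQDivisionRing k D q x y) {s : D} {p : ℕ × ℕ}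
    (h : HasLead k x y s p) : s ≠ 0 := by
  rintro rfl
  exact h.not_mem hD (zero_mem _)

theorem HasLead.unique (hD : IsQDivisionRing k D q x y) {s : D} {p p' : ℕ × ℕ}
    (h : HasLead k x y s p) (h' : HasLead k x y s p') : p = p' := by
  apply lexDegree_injective
  refine le_antisymm (not_lt.1 fun hlt => ?_) (not_lt.1 fun hlt => ?_)
  · exact h.not_mem hD (h'.mem_lowerTerms hlt)
  · exact h'.not_mem hD (h.mem_lowerTerms hlt)

theorem monomial_mul_mem_lowerTerms (hD : IsQDivisionRing k D q x y) (p : ℕ × ℕ)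
    {γ : ℤ ×ₗ ℤ} {s : D} (hs : s ∈ lowerTerms k x y γ) :
    y ^ p.1 * x ^ p.2 * s ∈ lowerTerms k x y (lexDegree p + γ) := by
  induction hs using Submodule.span_induction with
  | mem s hs =>
    obtain ⟨p', hp', rfl⟩ := hs
    simp only [monomial_mul_monomial_of_mul_eq_smul hD.mul_eq_smul]
    refine Submodule.smul_mem _ _ (monomial_mem_lowerTerms ?_)
    rw [lexDegree_add]
    exact add_lt_add_right hp' _
  | zero => simp
  | add a b _ _ iha ihb => rw [mul_add]; exact add_mem iha ihb
  | smul c a _ ih => rw [mul_smul_comm]; exact Submodule.smul_mem _ _ ih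

theorem mul_monomial_mem_lowerTerms (hD : IsQDivisionRing k D q x y) (p : ℕ × ℕ)
    {γ : ℤ ×ₗ ℤ} {s : D} (hs : s ∈ lowerTerms k x y γ) :
    s * (y ^ p.1 * x ^ p.2) ∈ lowerTerms k x y (γ + lexDegree p) := by
  induction hs using Submodule.span_induction with
  | mem s hs =>
    obtain ⟨p', hp', rfl⟩ := hs
    simp only [monomial_mul_monomial_of_mul_eq_smul hD.mul_eq_smul]
    refine Submodule.smul_mem _ _ (monomial_mem_lowerTerms ?_)
    rw [lexDegree_add]
    exact add_lt_add_left hp' _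
  | zero => simp
  | add a b _ _ iha ihb => rw [add_mul]; exact add_mem iha ihb
  | smul c a _ ih => rw [smul_mul_assoc]; exact Submodule.smul_mem _ _ ih

theorem mul_mem_lowerTerms (hD : IsQDivisionRing k D q x y)
    {γ : ℤ ×ₗ ℤ} {p : ℕ × ℕ} {s s' : D} (hs : s ∈ lowerTerms k x y γ)
    (hs' : s' ∈ lowerTerms k x y (lexDegree p)) :
    s * s' ∈ lowerTerms k x y (γ + lexDegree p) := by
  induction hs' using Submodule.span_induction with
  | mem s' hs' =>
    obtain ⟨p', hp', rfl⟩ := hs'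
    exact lowerTerms_mono (add_le_add_right (le_of_lt hp') _)
      (mul_monomial_mem_lowerTerms hD p' hs)
  | zero => simp
  | add a b _ _ iha ihb => rw [mul_add]; exact add_mem iha ihb
  | smul c a _ ih => rw [mul_smul_comm]; exact Submodule.smul_mem _ _ ih

theorem HasLead.mul (hD : IsQDivisionRing k D q x y) (hq : q ≠ 0) {s s' : D} {p p' : ℕ × ℕ}
    (h : HasLead k x y s p) (h' : HasLead k x y s' p') :
    HasLead k x y (s * s') (p + p') := by
  obtain ⟨c, hc, hs⟩ := h
  obtain ⟨c', hc', hs'⟩ := h'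
  refine ⟨c * c' * q ^ (p.2 * p'.1), by simp [hc, hc', hq], ?_⟩
  rw [lexDegree_add, mul_smul, ← monomial_mul_monomial_of_mul_eq_smul hD.mul_eq_smul]
  generalize hm : y ^ p.1 * x ^ p.2 = m at *
  generalize hm' : y ^ p'.1 * x ^ p'.2 = m' at *
  have e : s * s' - (c * c') • (m * m') =
      (s - c • m) * (s' - c' • m') + c • (m * (s' - c' • m')) + c' • ((s - c • m) * m') := by
    simp only [mul_sub, sub_mul, smul_sub, mul_smul_comm, smul_mul_assoc, smul_smul, mul_comm c' c]
    abel
  rw [e]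
  refine add_mem (add_mem (mul_mem_lowerTerms hD hs hs') (Submodule.smul_mem _ _ ?_))
    (Submodule.smul_mem _ _ ?_)
  · rw [← hm]
    exact monomial_mul_mem_lowerTerms hD p hs'
  · rw [← hm']
    exact mul_monomial_mem_lowerTerms hD p' hs

theorem exists_hasLead (hD : IsQDivisionRing k D q x y) {s : D}
    (hs : s ∈ Algebra.adjoin k ({x, y} : Set D)) (hs0 : s ≠ 0) :
    ∃ p, HasLead k x y s p := by
  obtain ⟨l, rfl⟩ := Finsupp.mem_span_range_iff_exists_finsupp.1
    (mem_span_monomials_of_mem_adjoin hD.mul_eq_smul hs)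
  have hl : l.support.Nonempty := by
    rw [Finset.nonempty_iff_ne_empty]
    intro h
    rw [Finsupp.support_eq_empty] at h
    exact hs0 (by simp [h])
  obtain ⟨p, hp, hmax⟩ := Finset.exists_max_image l.support lexDegree hl
  refine ⟨p, l p, Finsupp.mem_support_iff.1 hp, ?_⟩
  rw [Finsupp.sum, ← Finset.add_sum_erase _ _ hp, add_sub_cancel_left]
  refine Submodule.sum_mem _ fun p' hp' => Submodule.smul_mem _ _ (monomial_mem_lowerTerms ?_)
  rw [Finset.mem_erase] at hp'
  exact lt_of_le_of_ne (hmax p' hp'.2) fun h => hp'.1 (lexDegree_injective h)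

/-- `d` is a fraction whose numerator and denominator have leading degrees differing by `γ`. -/
def HasVal (k : Type*) {D : Type*} [Field k] [DivisionRing D] [Algebra k D] (x y : D)
    (d : D) (γ : ℤ ×ₗ ℤ) : Prop :=
  ∃ (t : D) (p r : ℕ × ℕ), t ∈ Algebra.adjoin k ({x, y} : Set D) ∧
    t * d ∈ Algebra.adjoin k ({x, y} : Set D) ∧
    HasLead k x y t p ∧ HasLead k x y (t * d) r ∧ lexDegree r = lexDegree p + γ

theorem HasVal.lexDegree_eq (hD : IsQDivisionRing k D q x y) (hq : q ≠ 0) {d : D} {γ : ℤ ×ₗ ℤ}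
    (h : HasVal k x y d γ) {t : D} {p : ℕ × ℕ} (hp : HasLead k x y t p)
    (htd : t * d ∈ Algebra.adjoin k ({x, y} : Set D)) :
    ∃ r, HasLead k x y (t * d) r ∧ lexDegree r = lexDegree p + γ := by
  obtain ⟨t', p', r', ht', -, hp', hr', e⟩ := h
  have ht0 := hp.ne_zero hD
  have hd0 : d ≠ 0 := right_ne_zero_of_mul (hr'.ne_zero hD)
  obtain ⟨r, hr⟩ := exists_hasLead hD htd (mul_ne_zero ht0 hd0)
  refine ⟨r, hr, ?_⟩
  obtain ⟨a, b, ha, hb, hb0, hab⟩ := hD.exists_ore t' ht0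
  have ha0 : a ≠ 0 := by
    rintro rfl
    rw [zero_mul] at hab
    exact mul_ne_zero hb0 (hp'.ne_zero hD) hab
  obtain ⟨m, hm⟩ := exists_hasLead hD ha ha0
  obtain ⟨n, hn⟩ := exists_hasLead hD hb hb0
  have e1 : n + p' = m + p :=
    (hn.mul hD hq hp').unique hD (by rw [hab]; exact hm.mul hD hq hp)
  have e2 : n + r' = m + r :=
    (hn.mul hD hq hr').unique hD
      (by rw [← mul_assoc, hab, mul_assoc]; exact hm.mul hD hq hr)
  have e1' := congrArg lexDegree e1
  have e2' := congrArg lexDegree e2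
  simp only [lexDegree_add] at e1' e2'
  rw [e, ← add_assoc, e1', add_assoc] at e2'
  exact (add_left_cancel e2').symm

theorem HasVal.ne_zero (hD : IsQDivisionRing k D q x y) {d : D} {γ : ℤ ×ₗ ℤ}
    (h : HasVal k x y d γ) : d ≠ 0 := by
  obtain ⟨t, p, r, -, -, -, hr, -⟩ := h
  exact right_ne_zero_of_mul (hr.ne_zero hD)

theorem HasVal.mul (hD : IsQDivisionRing k D q x y) (hq : q ≠ 0) {d e : D} {γ δ : ℤ ×ₗ ℤ}
    (hd : HasVal k x y d γ) (he : HasVal k x y e δ) : HasVal k x y (d * e) (γ + δ) := by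
  obtain ⟨t, ht, ht0, htd, hte⟩ := hD.exists_chain_denom d e
  obtain ⟨p, hp⟩ := exists_hasLead hD ht ht0
  obtain ⟨r, hr, hr'⟩ := hd.lexDegree_eq hD hq hp htd
  obtain ⟨m, hm, hm'⟩ := he.lexDegree_eq hD hq hr hte
  rw [mul_assoc] at hm hte
  exact ⟨t, p, m, ht, hte, hp, hm, by rw [hm', hr', add_assoc]⟩

theorem HasVal.add_of_lt (hD : IsQDivisionRing k D q x y) (hq : q ≠ 0) {d e : D}
    {γ δ : ℤ ×ₗ ℤ} (hd : HasVal k x y d γ) (he : HasVal k x y e δ) (h : γ < δ) :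
    HasVal k x y (d + e) δ := by
  obtain ⟨t, ht, ht0, htd, hte⟩ := hD.exists_common_denom d e
  obtain ⟨p, hp⟩ := exists_hasLead hD ht ht0
  obtain ⟨r, hr, hr'⟩ := hd.lexDegree_eq hD hq hp htd
  obtain ⟨m, hm, hm'⟩ := he.lexDegree_eq hD hq hp hte
  refine ⟨t, p, m, ht, by rw [mul_add]; exact add_mem htd hte, hp, ?_, hm'⟩
  rw [mul_add]
  refine hm.add_of_mem (hr.mem_lowerTerms ?_)
  rw [hr', hm']
  exact add_lt_add_right h _

theorem HasLead.hasVal {s : D} {p : ℕ × ℕ} (hs : s ∈ Algebra.adjoin k ({x, y} : Set D))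
    (h : HasLead k x y s p) : HasVal k x y s (lexDegree p) := by
  refine ⟨1, 0, p, one_mem _, by rwa [one_mul], ?_, by rwa [one_mul], ?_⟩
  · simpa using hasLead_monomial (k := k) (x := x) (y := y) 0
  · rw [show lexDegree 0 = 0 from rfl, zero_add]

theorem hasVal_algebraMap {c : k} (hc : c ≠ 0) : HasVal k x y (algebraMap k D c) 0 :=
  HasLead.hasVal (p := 0) (Subalgebra.algebraMap_mem _ c)
    ⟨c, hc, by simp [Algebra.algebraMap_eq_smul_one]⟩

theorem hasVal_one : HasVal k x y (1 : D) 0 := by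
  simpa using hasVal_algebraMap (x := x) (y := y) (one_ne_zero (α := k))

theorem hasVal_x : HasVal k x y x (toLex (0, 1)) :=
  HasLead.hasVal (p := (0, 1)) (Algebra.subset_adjoin (by simp))
    (by simpa using hasLead_monomial (k := k) (x := x) (y := y) (0, 1))

theorem hasVal_y : HasVal k x y y (toLex (1, 0)) :=
  HasLead.hasVal (p := (1, 0)) (Algebra.subset_adjoin (by simp))
    (by simpa using hasLead_monomial (k := k) (x := x) (y := y) (1, 0))

theorem HasVal.inv (hD : IsQDivisionRing k D q x y) {d : D} {γ : ℤ ×ₗ ℤ}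
    (h : HasVal k x y d γ) : HasVal k x y d⁻¹ (-γ) := by
  have hd0 := h.ne_zero hD
  obtain ⟨t, p, r, ht, htd, hp, hr, e⟩ := h
  refine ⟨t * d, r, p, htd, ?_, hr, ?_, ?_⟩
  · rwa [mul_inv_cancel_right₀ hd0]
  · rwa [mul_inv_cancel_right₀ hd0]
  · rw [e, add_neg_cancel_right]

theorem HasVal.smul (hD : IsQDivisionRing k D q x y) (hq : q ≠ 0) {d : D} {γ : ℤ ×ₗ ℤ}
    (h : HasVal k x y d γ) {c : k} (hc : c ≠ 0) : HasVal k x y (c • d) γ := by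
  rw [Algebra.smul_def, ← zero_add γ]
  exact (hasVal_algebraMap hc).mul hD hq h

theorem HasVal.neg (hD : IsQDivisionRing k D q x y) (hq : q ≠ 0) {d : D} {γ : ℤ ×ₗ ℤ}
    (h : HasVal k x y d γ) : HasVal k x y (-d) γ := by
  rw [← neg_one_smul k]
  exact h.smul hD hq (neg_ne_zero.2 one_ne_zero)

theorem HasVal.sub_of_lt (hD : IsQDivisionRing k D q x y) (hq : q ≠ 0) {d e : D}
    {γ δ : ℤ ×ₗ ℤ} (hd : HasVal k x y d γ) (he : HasVal k x y e δ) (h : δ < γ) :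
    HasVal k x y (d - e) γ := by
  rw [sub_eq_neg_add]
  exact (he.neg hD hq).add_of_lt hD hq hd h

theorem HasVal.pow (hD : IsQDivisionRing k D q x y) (hq : q ≠ 0) {d : D} {γ : ℤ ×ₗ ℤ}
    (h : HasVal k x y d γ) (n : ℕ) : HasVal k x y (d ^ n) (n • γ) := by
  induction n with
  | zero => simpa using hasVal_one
  | succ n ih =>
    rw [pow_succ, succ_nsmul]
    exact ih.mul hD hq h

theorem exists_hasVal_sum (hD : IsQDivisionRing k D q x y) (hq : q ≠ 0) {ι : Type*}
    {f : ι → D} {γ : ι → ℤ ×ₗ ℤ} (hf : ∀ i, HasVal k x y (f i) (γ i))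
    (hγ : Function.Injective γ) {g : ι → k} (s : Finset ι) (hs : s.Nonempty)
    (hg : ∀ i ∈ s, g i ≠ 0) : ∃ i ∈ s, HasVal k x y (∑ i ∈ s, g i • f i) (γ i) := by
  classical
  induction s using Finset.induction_on_max_value γ with
  | empty => exact absurd hs Finset.not_nonempty_empty
  | insert a s ha hmax ih =>
    refine ⟨a, Finset.mem_insert_self a s, ?_⟩
    have hga := (hf a).smul hD hq (hg a (Finset.mem_insert_self a s))
    rw [Finset.sum_insert ha]
    rcases s.eq_empty_or_nonempty with rfl | hne
    · simpa using hga
    · obtain ⟨j, hj, hj'⟩ := ih hne fun i hi => hg i (Finset.mem_insert_of_mem hi)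
      rw [add_comm]
      refine hj'.add_of_lt hD hq hga (lt_of_le_of_ne (hmax j hj) fun h => ha ?_)
      rwa [← hγ h]

theorem linearIndependent_of_hasVal (hD : IsQDivisionRing k D q x y) (hq : q ≠ 0) {ι : Type*}
    {f : ι → D} {γ : ι → ℤ ×ₗ ℤ} (hf : ∀ i, HasVal k x y (f i) (γ i))
    (hγ : Function.Injective γ) : LinearIndependent k f := by
  classical
  rw [linearIndependent_iff']
  intro s g hsum i hi
  by_contra hgi
  obtain ⟨j, -, hj⟩ := exists_hasVal_sum hD hq hf hγ (g := g) (s.filter fun i => g i ≠ 0)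
    ⟨i, Finset.mem_filter.2 ⟨hi, hgi⟩⟩ fun i hi => (Finset.mem_filter.1 hi).2
  refine hj.ne_zero hD ?_
  rw [← hsum]
  refine Finset.sum_subset (Finset.filter_subset _ _) fun j hj hj' => ?_
  have : g j = 0 := by simpa [hj] using hj'
  rw [this, zero_smul]

theorem linearIndependent_monomials_of_hasVal (hD : IsQDivisionRing k D q x y) (hq : q ≠ 0)
    {u v : D} {a b c d : ℤ} (hu : HasVal k x y u (toLex (a, b)))
    (hv : HasVal k x y v (toLex (c, d))) (hdet : a * d - b * c ≠ 0) :
    LinearIndependent k fun p : ℕ × ℕ => v ^ p.1 * u ^ p.2 := by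
  refine linearIndependent_of_hasVal hD hq
    (fun p => (hv.pow hD hq p.1).mul hD hq (hu.pow hD hq p.2)) ?_
  rintro ⟨i, j⟩ ⟨i', j'⟩ h
  have h' : (i : ℤ) * c + j * a = i' * c + j' * a ∧ (i : ℤ) * d + j * b = i' * d + j' * b := by
    have h1 := congrArg (fun γ : ℤ ×ₗ ℤ => (ofLex γ).1) h
    have h2 := congrArg (fun γ : ℤ ×ₗ ℤ => (ofLex γ).2) h
    simp only [nsmul_eq_mul] at h1 h2
    exact ⟨h1, h2⟩
  obtain ⟨h1, h2⟩ := h'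
  have hi : ((i : ℤ) - i') * (a * d - b * c) = 0 := by linear_combination a * h2 - b * h1
  have hj : ((j : ℤ) - j') * (a * d - b * c) = 0 := by linear_combination d * h1 - c * h2
  have := (mul_eq_zero.1 hi).resolve_right hdet
  have := (mul_eq_zero.1 hj).resolve_right hdet
  ext <;> simp only <;> omega

end Leading

end IsQDivisionRing

namespace IsQDivisionRing

section FixedRing

variable {k D : Type*} [Field k] [DivisionRing D] [Algebra k D] {q : k} {x y : D}

/-- If `L` is a division subring and `L + Lz` contains `x`, `zx`, `y`, `zy`, then it is all
of `D`. -/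
theorem exists_eq_add_mul (hD : IsQDivisionRing k D q x y) {L : Subalgebra k D}
    (hinv : ∀ a ∈ L, a⁻¹ ∈ L) {z : D}
    (hx : ∃ a ∈ L, ∃ b ∈ L, x = a + b * z) (hzx : ∃ a ∈ L, ∃ b ∈ L, z * x = a + b * z)
    (hy : ∃ a ∈ L, ∃ b ∈ L, y = a + b * z) (hzy : ∃ a ∈ L, ∃ b ∈ L, z * y = a + b * z)
    (d : D) : ∃ a ∈ L, ∃ b ∈ L, d = a + b * z := by
  have hcomb : ∀ c ∈ L, ∀ c' ∈ L, ∀ e e' : D, (∃ a ∈ L, ∃ b ∈ L, e = a + b * z) →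
      (∃ a ∈ L, ∃ b ∈ L, e' = a + b * z) → ∃ a ∈ L, ∃ b ∈ L, c * e + c' * e' = a + b * z := by
    rintro c hc c' hc' _ _ ⟨a, ha, b, hb, rfl⟩ ⟨a', ha', b', hb', rfl⟩
    refine ⟨c * a + c' * a', add_mem (mul_mem hc ha) (mul_mem hc' ha'),
      c * b + c' * b', add_mem (mul_mem hc hb) (mul_mem hc' hb'), ?_⟩
    noncomm_ring
  have hmul : ∀ s ∈ Algebra.adjoin k ({x, y} : Set D), ∀ e : D,
      (∃ a ∈ L, ∃ b ∈ L, e = a + b * z) → ∃ a ∈ L, ∃ b ∈ L, e * s = a + b * z := by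
    intro s hs
    induction hs using Algebra.adjoin_induction with
    | mem s hs =>
      rintro _ ⟨a, ha, b, hb, rfl⟩
      rw [add_mul, mul_assoc]
      rcases hs with rfl | rfl
      · exact hcomb a ha b hb _ _ hx hzx
      · exact hcomb a ha b hb _ _ hy hzy
    | algebraMap c =>
      intro e he
      rw [← Algebra.commutes]
      simpa using hcomb _ (L.algebraMap_mem c) 0 (zero_mem L) e e he he
    | add s t _ _ ihs iht =>
      intro e he
      rw [mul_add]
      simpa using hcomb 1 (one_mem L) 1 (one_mem L) _ _ (ihs e he) (iht e he)
    | mul s t _ _ ihs iht =>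
      intro e he
      rw [← mul_assoc]
      exact iht _ (ihs e he)
  obtain ⟨s, t, hs, ht, ht0, rfl⟩ := hD.exists_frac d
  refine hmul s hs _ ?_
  obtain ⟨a, ha, b, hb, e1⟩ := hmul t ht 1 ⟨1, one_mem L, 0, zero_mem L, by simp⟩
  obtain ⟨a', ha', b', hb', e2⟩ := hmul t ht z ⟨0, zero_mem L, 1, one_mem L, by simp⟩
  rw [one_mul] at e1
  have hL : t ∈ L → ∃ a ∈ L, ∃ b ∈ L, t⁻¹ = a + b * z := fun h =>
    ⟨t⁻¹, hinv t h, 0, zero_mem L, by simp⟩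
  rcases eq_or_ne b 0 with rfl | hb0
  · exact hL (by rw [e1]; simpa using ha)
  have e3 : (z - b' * b⁻¹) * t = a' - b' * b⁻¹ * a := by
    rw [sub_mul, e2, e1, mul_add, mul_assoc b' b⁻¹ (b * z), inv_mul_cancel_left₀ hb0]
    abel
  have hw : b' * b⁻¹ ∈ L := mul_mem hb' (hinv b hb)
  have hc : a' - b' * b⁻¹ * a ∈ L := sub_mem ha' (mul_mem hw ha)
  generalize b' * b⁻¹ = w at e3 hw hc
  generalize a' - w * a = c at e3 hc
  rcases eq_or_ne c 0 with rfl | hc0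
  · have hz : z ∈ L := by
      rw [sub_eq_zero.1 ((mul_eq_zero.1 e3).resolve_right ht0)]
      exact hw
    exact hL (by rw [e1]; exact add_mem ha (mul_mem hb hz))
  · refine ⟨-(c⁻¹ * w), neg_mem (mul_mem (hinv c hc) hw), c⁻¹, hinv c hc, ?_⟩
    apply mul_right_cancel₀ ht0
    rw [inv_mul_cancel₀ ht0, neg_add_eq_sub, ← mul_sub, mul_assoc, e3, inv_mul_cancel₀ hc0]

/-- Two `q`-commuting elements fixed by `σ` generate the fixed ring as soon as `D` is a quadratic
extension, generated by an element moved by `σ`, of the division ring they generate. -/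
theorem exists_algHom_range_eq_fixed (hD : IsQDivisionRing k D q x y) {σ : D →ₐ[k] D} {u v z : D}
    (huv : u * v = q • (v * u)) (hli : LinearIndependent k fun p : ℕ × ℕ => v ^ p.1 * u ^ p.2)
    (hσu : σ u = u) (hσv : σ v = v) (hσz : σ z ≠ z)
    (hgen : ∀ L : Subalgebra k D, (∀ a ∈ L, a⁻¹ ∈ L) → u ∈ L → v ∈ L →
      (∃ a ∈ L, ∃ b ∈ L, x = a + b * z) ∧ (∃ a ∈ L, ∃ b ∈ L, z * x = a + b * z) ∧
      (∃ a ∈ L, ∃ b ∈ L, y = a + b * z) ∧ (∃ a ∈ L, ∃ b ∈ L, z * y = a + b * z)) :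
    ∃ F : D →ₐ[k] D, F x = u ∧ F y = v ∧ ∀ d, σ d = d ↔ ∃ e, F e = d := by
  obtain ⟨F, hFx, hFy⟩ := exists_algHom hD huv hli
  have hσF : ∀ e, σ (F e) = F e := fun e =>
    congrArg (fun f : D →ₐ[k] D => f e)
      (hD.algHom_ext (f := σ.comp F) (g := F) (by simp [hFx, hσu]) (by simp [hFy, hσv]))
  refine ⟨F, hFx, hFy, fun d => ⟨fun hd => ?_, ?_⟩⟩
  · have hinv : ∀ a ∈ F.range, a⁻¹ ∈ F.range := by
      rintro _ ⟨e, rfl⟩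
      exact ⟨e⁻¹, map_inv₀ F e⟩
    obtain ⟨h1, h2, h3, h4⟩ := hgen F.range hinv ⟨x, hFx⟩ ⟨y, hFy⟩
    obtain ⟨_, ⟨a, rfl⟩, _, ⟨b, rfl⟩, rfl⟩ := hD.exists_eq_add_mul hinv h1 h2 h3 h4 d
    refine ⟨a, ?_⟩
    have h5 : F b * (σ z - z) = 0 := by
      have h6 : F a + F b * σ z = F a + F b * z := by
        simpa [hσF] using hd
      rw [mul_sub, sub_eq_zero]
      exact add_left_cancel h6
    have h7 : F b = 0 := (mul_eq_zero.1 h5).resolve_right (sub_ne_zero.2 hσz)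
    change F a = F a + F b * z
    rw [h7, zero_mul, add_zero]
  · rintro ⟨e, rfl⟩
    exact hσF e

theorem hasVal_x_inv (hD : IsQDivisionRing k D q x y) : HasVal k x y x⁻¹ (toLex (0, -1)) :=
  hasVal_x.inv hD

theorem hasVal_y_inv (hD : IsQDivisionRing k D q x y) : HasVal k x y y⁻¹ (toLex (-1, 0)) :=
  hasVal_y.inv hD

theorem y_mul_x_inv (hD : IsQDivisionRing k D q x y) : y * x⁻¹ = q • (x⁻¹ * y) := by
  have hx := hD.x_ne_zero
  apply mul_left_cancel₀ hx
  apply mul_right_cancel₀ hx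
  rw [mul_smul_comm, smul_mul_assoc, mul_inv_cancel_left₀ hx, ← mul_assoc,
    inv_mul_cancel_right₀ hx, hD.mul_eq_smul]

theorem y_inv_mul_x_inv (hD : IsQDivisionRing k D q x y) (hq : q ≠ 0) :
    y⁻¹ * x⁻¹ = q⁻¹ • (x⁻¹ * y⁻¹) := by
  have hy := hD.y_ne_zero
  apply mul_left_cancel₀ hy
  apply mul_right_cancel₀ hy
  rw [mul_smul_comm, smul_mul_assoc, mul_inv_cancel_left₀ hy, ← mul_assoc,
    inv_mul_cancel_right₀ hy, hD.y_mul_x_inv, smul_smul, inv_mul_cancel₀ hq, one_smul]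

section Inversion

/-- The first generator of the ring fixed by `x ↦ x⁻¹`, `y ↦ y⁻¹`. -/
def invGenX (x y : D) : D := (x - x⁻¹) * (y⁻¹ - y)⁻¹

/-- The second generator of the ring fixed by `x ↦ x⁻¹`, `y ↦ y⁻¹`. -/
def invGenY (x y : D) : D := (x * y - x⁻¹ * y⁻¹) * (y⁻¹ - y)⁻¹

theorem hasVal_sub_inv_y (hD : IsQDivisionRing k D q x y) (hq : q ≠ 0) :
    HasVal k x y (y⁻¹ - y) (toLex (1, 0)) := by
  rw [← neg_sub]
  exact (hasVal_y.sub_of_lt hD hq hD.hasVal_y_inv (by decide)).neg hD hq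

theorem hasVal_invGenX (hD : IsQDivisionRing k D q x y) (hq : q ≠ 0) :
    HasVal k x y (invGenX x y) (toLex (-1, 1)) :=
  (hasVal_x.sub_of_lt hD hq hD.hasVal_x_inv (by decide)).mul hD hq
    ((hD.hasVal_sub_inv_y hq).inv hD)

theorem hasVal_invGenY (hD : IsQDivisionRing k D q x y) (hq : q ≠ 0) :
    HasVal k x y (invGenY x y) (toLex (0, 1)) :=
  ((hasVal_x.mul hD hq hasVal_y).sub_of_lt hD hq (hD.hasVal_x_inv.mul hD hq hD.hasVal_y_inv)
    (by decide)).mul hD hq ((hD.hasVal_sub_inv_y hq).inv hD)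

theorem invGenX_mul_y_sub (hD : IsQDivisionRing k D q x y) (hq : q ≠ 0) :
    invGenX x y * y - invGenY x y = x⁻¹ := by
  have hy := hD.y_ne_zero
  have hY := (hD.hasVal_sub_inv_y hq).ne_zero hD
  have hc : (y⁻¹ - y)⁻¹ * y = y * (y⁻¹ - y)⁻¹ := by
    apply mul_left_cancel₀ hY
    apply mul_right_cancel₀ hY
    rw [mul_inv_cancel_left₀ hY, ← mul_assoc, inv_mul_cancel_right₀ hY, mul_sub, sub_mul,
      mul_inv_cancel₀ hy, inv_mul_cancel₀ hy]
  apply mul_right_cancel₀ hY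
  rw [sub_mul, invGenX, invGenY, mul_assoc (x - x⁻¹), hc, ← mul_assoc, inv_mul_cancel_right₀ hY,
    inv_mul_cancel_right₀ hY]
  noncomm_ring

theorem invGenX_mul_y_inv_sub (hD : IsQDivisionRing k D q x y) (hq : q ≠ 0) :
    invGenX x y * y⁻¹ - invGenY x y = x := by
  have hY := (hD.hasVal_sub_inv_y hq).ne_zero hD
  have h1 : invGenX x y * (y⁻¹ - y) = x - x⁻¹ := by
    rw [invGenX, inv_mul_cancel_right₀ hY]
  have h2 := hD.invGenX_mul_y_sub hq
  rw [mul_sub, sub_eq_iff_eq_add] at h1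
  rw [h1, add_sub_assoc, h2, sub_add_cancel]

theorem x_mul_x_inv_expand (hD : IsQDivisionRing k D q x y) (hq : q ≠ 0) :
    q⁻¹ • (invGenX x y * invGenX x y) - q⁻¹ • (invGenX x y * invGenY x y * y⁻¹) -
      invGenY x y * invGenX x y * y + invGenY x y * invGenY x y = 1 := by
  have hx := hD.x_ne_zero
  have hy := hD.y_ne_zero
  have h1 := hD.invGenX_mul_y_sub hq
  have h2 := hD.invGenX_mul_y_inv_sub hq
  have h3 := hD.y_inv_mul_x_inv hq
  generalize invGenX x y = u at *
  generalize invGenY x y = v at *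
  have h4 : x⁻¹ * y⁻¹ = u - v * y⁻¹ := by
    rw [← h1, sub_mul, mul_inv_cancel_right₀ hy]
  calc _ = u * (q⁻¹ • (u - v * y⁻¹)) - v * (u * y - v) := by
        rw [mul_smul_comm, mul_sub, smul_sub]
        noncomm_ring
    _ = (u * y⁻¹ - v) * x⁻¹ := by rw [← h4, ← h3, h1, sub_mul, mul_assoc]
    _ = 1 := by rw [h2, mul_inv_cancel₀ hx]

theorem x_inv_mul_x_expand (hD : IsQDivisionRing k D q x y) (hq : q ≠ 0) :
    q⁻¹ • (invGenX x y * invGenX x y) - q⁻¹ • (invGenX x y * invGenY x y * y) -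
      invGenY x y * invGenX x y * y⁻¹ + invGenY x y * invGenY x y = 1 := by
  have hx := hD.x_ne_zero
  have hy := hD.y_ne_zero
  have h1 := hD.invGenX_mul_y_sub hq
  have h2 := hD.invGenX_mul_y_inv_sub hq
  have h3 : y * x = q⁻¹ • (x * y) := by
    rw [hD.mul_eq_smul, smul_smul, inv_mul_cancel₀ hq, one_smul]
  generalize invGenX x y = u at *
  generalize invGenY x y = v at *
  have h4 : x * y = u - v * y := by
    rw [← h2, sub_mul, inv_mul_cancel_right₀ hy]
  calc _ = u * (q⁻¹ • (u - v * y)) - v * (u * y⁻¹ - v) := by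
        rw [mul_smul_comm, mul_sub, smul_sub]
        noncomm_ring
    _ = (u * y - v) * x := by rw [← h4, ← h3, h2, sub_mul, mul_assoc]
    _ = 1 := by rw [h1, inv_mul_cancel₀ hx]

theorem invGenX_mul_invGenY (hD : IsQDivisionRing k D q x y) (hq : q ≠ 0) :
    invGenX x y * invGenY x y = q • (invGenY x y * invGenX x y) := by
  have h1 := (hD.x_mul_x_inv_expand hq).trans (hD.x_inv_mul_x_expand hq).symm
  have hY := (hD.hasVal_sub_inv_y hq).ne_zero hD
  have h2 : (q⁻¹ • (invGenX x y * invGenY x y) - invGenY x y * invGenX x y) * (y⁻¹ - y) = 0 := by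
    rw [← sub_eq_zero] at h1
    rw [← neg_eq_zero, ← h1, sub_mul, smul_mul_assoc, mul_sub, mul_sub, smul_sub]
    abel
  rw [← sub_eq_zero.1 ((mul_eq_zero.1 h2).resolve_right hY), smul_smul, mul_inv_cancel₀ hq,
    one_smul]

theorem invGen_mul_trace (hD : IsQDivisionRing k D q x y) (hq : q ≠ 0) :
    invGenY x y * invGenX x y * (y + y⁻¹) =
      q⁻¹ • (invGenX x y * invGenX x y) + invGenY x y * invGenY x y - 1 := by
  have h := hD.x_mul_x_inv_expand hq
  rw [hD.invGenX_mul_invGenY hq, smul_mul_assoc, smul_smul, inv_mul_cancel₀ hq, one_smul] at h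
  rw [← h, mul_add]
  abel

theorem exists_algHom_range_eq_inversion_fixed (hD : IsQDivisionRing k D q x y) (hq : q ≠ 0)
    {τ : D →ₐ[k] D} (hτx : τ x = x⁻¹) (hτy : τ y = y⁻¹) :
    ∃ F : D →ₐ[k] D, F x = invGenX x y ∧ F y = invGenY x y ∧ ∀ d, τ d = d ↔ ∃ e, F e = d := by
  have hy := hD.y_ne_zero
  have hY := (hD.hasVal_sub_inv_y hq).ne_zero hD
  refine hD.exists_algHom_range_eq_fixed (z := y) (hD.invGenX_mul_invGenY hq)
    (linearIndependent_monomials_of_hasVal hD hq (hD.hasVal_invGenX hq) (hD.hasVal_invGenY hq)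
      (by norm_num)) ?_ ?_ ?_ ?_
  · rw [invGenX, map_mul, map_inv₀, map_sub, map_sub, map_inv₀, map_inv₀, hτx, hτy, inv_inv,
      inv_inv, ← neg_sub x, ← neg_sub y⁻¹, inv_neg, neg_mul_neg]
  · rw [invGenY, map_mul, map_inv₀, map_sub, map_sub, map_mul, map_mul, map_inv₀, map_inv₀, hτx,
      hτy, inv_inv, inv_inv, ← neg_sub (x * y), ← neg_sub y⁻¹, inv_neg, neg_mul_neg]
  · rw [hτy]
    exact sub_ne_zero.1 hY
  · intro L hinv hu hv
    have h2 := hD.invGenX_mul_y_inv_sub hq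
    have hw : y + y⁻¹ ∈ L := by
      have hvu0 := mul_ne_zero ((hD.hasVal_invGenY hq).ne_zero hD)
        ((hD.hasVal_invGenX hq).ne_zero hD)
      have h3 := hD.invGen_mul_trace hq
      rw [← inv_mul_cancel_left₀ hvu0 (y + y⁻¹), h3]
      exact mul_mem (hinv _ (mul_mem hv hu))
        (sub_mem (add_mem (L.smul_mem (mul_mem hu hu) _) (mul_mem hv hv)) (one_mem L))
    generalize invGenX x y = u at *
    generalize invGenY x y = v at *
    generalize hwe : y + y⁻¹ = w at *
    have hyinv : y⁻¹ = w - y := by rw [← hwe, add_sub_cancel_left]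
    refine ⟨⟨u * w - v, sub_mem (mul_mem hu hw) hv, -u, neg_mem hu, ?_⟩,
      ⟨q⁻¹ • u, L.smul_mem hu _, -(q⁻¹ • v), neg_mem (L.smul_mem hv _), ?_⟩,
      ⟨0, zero_mem L, 1, one_mem L, by simp⟩, ⟨-1, neg_mem (one_mem L), w, hw, ?_⟩⟩
    · rw [← h2, hyinv]
      noncomm_ring
    · have h3 : y * x = q⁻¹ • (x * y) := by
        rw [hD.mul_eq_smul, smul_smul, inv_mul_cancel₀ hq, one_smul]
      rw [h3]
      conv_lhs => rw [← h2]
      rw [sub_mul, inv_mul_cancel_right₀ hy, smul_sub, neg_mul, smul_mul_assoc, sub_eq_add_neg]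
    · rw [← hwe, add_mul, inv_mul_cancel₀ hy]
      abel

end Inversion

section Conic

/-- The image of `y` under the involution `x ↦ -x⁻¹`, `y ↦ y⁻¹(qx⁻¹ - x)`. -/
def conicConj (q : k) (x y : D) : D := y⁻¹ * (q • x⁻¹ - x)

/-- The first generator of the ring fixed by `x ↦ -x⁻¹`, `y ↦ y⁻¹(qx⁻¹ - x)`. -/
def conicGenX (q : k) (x y : D) : D := (y - conicConj q x y) * (x + x⁻¹)⁻¹

/-- The constant term of `y` written as a linear polynomial in `x` over the fixed ring. -/
def conicConst (q : k) (x y : D) : D := (y * x⁻¹ + conicConj q x y * x) * (x + x⁻¹)⁻¹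

/-- The second generator of the ring fixed by `x ↦ -x⁻¹`, `y ↦ y⁻¹(qx⁻¹ - x)`. -/
def conicGenY (q : k) (x y : D) : D :=
  conicConst q x y * conicGenX q x y + algebraMap k D q

theorem hasVal_add_inv_x (hD : IsQDivisionRing k D q x y) (hq : q ≠ 0) :
    HasVal k x y (x + x⁻¹) (toLex (0, 1)) := by
  rw [add_comm]
  exact hD.hasVal_x_inv.add_of_lt hD hq hasVal_x (by decide)

theorem hasVal_conicConj (hD : IsQDivisionRing k D q x y) (hq : q ≠ 0) :
    HasVal k x y (conicConj q x y) (toLex (-1, 1)) := by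
  refine hD.hasVal_y_inv.mul hD hq (δ := toLex (0, 1)) ?_
  rw [← neg_sub]
  exact (hasVal_x.sub_of_lt hD hq (hD.hasVal_x_inv.smul hD hq hq) (by decide)).neg hD hq

theorem hasVal_conicGenX (hD : IsQDivisionRing k D q x y) (hq : q ≠ 0) :
    HasVal k x y (conicGenX q x y) (toLex (1, -1)) :=
  (hasVal_y.sub_of_lt hD hq (hD.hasVal_conicConj hq) (by decide)).mul hD hq
    ((hD.hasVal_add_inv_x hq).inv hD)

theorem hasVal_conicConst (hD : IsQDivisionRing k D q x y) (hq : q ≠ 0) :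
    HasVal k x y (conicConst q x y) (toLex (1, -2)) := by
  rw [conicConst, add_comm (y * x⁻¹)]
  exact (((hD.hasVal_conicConj hq).mul hD hq hasVal_x).add_of_lt hD hq
    (hasVal_y.mul hD hq hD.hasVal_x_inv) (by decide)).mul hD hq ((hD.hasVal_add_inv_x hq).inv hD)

theorem hasVal_conicGenY (hD : IsQDivisionRing k D q x y) (hq : q ≠ 0) :
    HasVal k x y (conicGenY q x y) (toLex (2, -3)) := by
  rw [conicGenY, add_comm]
  exact (hasVal_algebraMap hq).add_of_lt hD hq
    ((hD.hasVal_conicConst hq).mul hD hq (hD.hasVal_conicGenX hq)) (by decide)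

theorem conicConst_add (hD : IsQDivisionRing k D q x y) (hq : q ≠ 0) :
    conicConst q x y + conicGenX q x y * x = y := by
  have hx := hD.x_ne_zero
  have hs := (hD.hasVal_add_inv_x hq).ne_zero hD
  have hc : x * (x + x⁻¹) = (x + x⁻¹) * x := by
    rw [mul_add, add_mul, mul_inv_cancel₀ hx, inv_mul_cancel₀ hx]
  apply mul_right_cancel₀ hs
  rw [add_mul, mul_assoc _ x, hc, ← mul_assoc, conicConst, conicGenX, inv_mul_cancel_right₀ hs,
    inv_mul_cancel_right₀ hs]
  noncomm_ring

theorem conicConst_sub (hD : IsQDivisionRing k D q x y) (hq : q ≠ 0) :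
    conicConst q x y - conicGenX q x y * x⁻¹ = conicConj q x y := by
  have hs := (hD.hasVal_add_inv_x hq).ne_zero hD
  have h1 : conicGenX q x y * (x + x⁻¹) = y - conicConj q x y := by
    rw [conicGenX, inv_mul_cancel_right₀ hs]
  rw [← sub_sub_self y (conicConj q x y), ← h1]
  nth_rw 3 [← hD.conicConst_add hq]
  noncomm_ring

theorem mul_conicConj (hD : IsQDivisionRing k D q x y) :
    y * conicConj q x y = q • x⁻¹ - x := by
  rw [conicConj, mul_inv_cancel_left₀ hD.y_ne_zero]

theorem x_inv_mul_y (hD : IsQDivisionRing k D q x y) (hq : q ≠ 0) :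
    x⁻¹ * y = q⁻¹ • (y * x⁻¹) := by
  rw [hD.y_mul_x_inv, smul_smul, inv_mul_cancel₀ hq, one_smul]

theorem conicConj_mul (hD : IsQDivisionRing k D q x y) (hq : q ≠ 0) :
    conicConj q x y * y = x⁻¹ - q • x := by
  apply mul_left_cancel₀ hD.y_ne_zero
  rw [← mul_assoc, hD.mul_conicConj, sub_mul, smul_mul_assoc, hD.x_inv_mul_y hq, smul_smul,
    mul_inv_cancel₀ hq, one_smul, hD.mul_eq_smul, mul_sub, mul_smul_comm]

theorem x_mul_conicConj (hD : IsQDivisionRing k D q x y) (hq : q ≠ 0) :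
    x * conicConj q x y = q⁻¹ • (conicConj q x y * x) := by
  have hx := hD.x_ne_zero
  apply mul_left_cancel₀ hD.y_ne_zero
  rw [mul_smul_comm, ← mul_assoc y, ← mul_assoc y, hD.mul_conicConj]
  have h : y * x = q⁻¹ • (x * y) := by
    rw [hD.mul_eq_smul, smul_smul, inv_mul_cancel₀ hq, one_smul]
  rw [h, smul_mul_assoc, mul_assoc, hD.mul_conicConj, mul_sub, sub_mul, mul_smul_comm,
    smul_mul_assoc, mul_inv_cancel₀ hx, inv_mul_cancel₀ hx]

theorem mul_conicConj_expand (hD : IsQDivisionRing k D q x y) (hq : q ≠ 0) :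
    conicConst q x y * conicConst q x y - conicConst q x y * conicGenX q x y * x⁻¹ +
      q⁻¹ • (conicGenX q x y * conicConst q x y * x) -
      q⁻¹ • (conicGenX q x y * conicGenX q x y) = q • x⁻¹ - x := by
  have hx := hD.x_ne_zero
  have h1 := hD.conicConst_add hq
  have h2 := hD.conicConst_sub hq
  have h3 := hD.x_mul_conicConj hq
  have h4 := hD.mul_conicConj
  generalize conicGenX q x y = R at *
  generalize conicConst q x y = m at *
  generalize conicConj q x y = y' at *
  have h5 : y' * x = m * x - R := by rw [← h2, sub_mul, inv_mul_cancel_right₀ hx]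
  calc _ = m * (m - R * x⁻¹) + R * (q⁻¹ • (m * x - R)) := by
        rw [mul_smul_comm, mul_sub R, smul_sub]
        noncomm_ring
    _ = (m + R * x) * y' := by rw [h2, ← h5, ← h3, add_mul, mul_assoc R]
    _ = _ := by rw [h1, h4]

theorem conicConj_mul_expand (hD : IsQDivisionRing k D q x y) (hq : q ≠ 0) :
    conicConst q x y * conicConst q x y + conicConst q x y * conicGenX q x y * x -
      q⁻¹ • (conicGenX q x y * conicConst q x y * x⁻¹) -
      q⁻¹ • (conicGenX q x y * conicGenX q x y) = x⁻¹ - q • x := by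
  have hx := hD.x_ne_zero
  have h1 := hD.conicConst_add hq
  have h2 := hD.conicConst_sub hq
  have h3 := hD.x_inv_mul_y hq
  have h4 := hD.conicConj_mul hq
  generalize conicGenX q x y = R at *
  generalize conicConst q x y = m at *
  generalize conicConj q x y = y' at *
  have h5 : y * x⁻¹ = m * x⁻¹ + R := by
    rw [← h1, add_mul, mul_inv_cancel_right₀ hx]
  calc _ = m * (m + R * x) - R * (q⁻¹ • (m * x⁻¹ + R)) := by
        rw [mul_smul_comm, mul_add R, smul_add]
        noncomm_ring
    _ = (m - R * x⁻¹) * y := by rw [h1, ← h5, ← h3, sub_mul, mul_assoc R]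
    _ = _ := by rw [h2, h4]

theorem conicGenX_mul_conicConst (hD : IsQDivisionRing k D q x y) (hq : q ≠ 0) :
    q⁻¹ • (conicGenX q x y * conicConst q x y) =
      conicConst q x y * conicGenX q x y + (q - 1) • (1 : D) := by
  have h1 := hD.mul_conicConj_expand hq
  have h2 := hD.conicConj_mul_expand hq
  have hs := (hD.hasVal_add_inv_x hq).ne_zero hD
  generalize conicGenX q x y = R at *
  generalize conicConst q x y = m at *
  apply mul_right_cancel₀ hs
  have h3 : q⁻¹ • (R * m) * (x + x⁻¹) - (m * R + (q - 1) • (1 : D)) * (x + x⁻¹) = 0 := by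
    have h4 := sub_eq_zero.2 (congrArg₂ (· - ·) h1 h2)
    rw [← h4]
    simp only [sub_smul, one_smul, add_mul, mul_add, sub_mul, smul_mul_assoc, one_mul]
    abel
  exact sub_eq_zero.1 h3

theorem conicGenX_mul_conicGenY (hD : IsQDivisionRing k D q x y) (hq : q ≠ 0) :
    conicGenX q x y * conicGenY q x y = q • (conicGenY q x y * conicGenX q x y) := by
  have h := hD.conicGenX_mul_conicConst hq
  rw [conicGenY]
  generalize conicGenX q x y = R at *
  generalize conicConst q x y = m at *
  have h1 : R * m = q • (m * R) + (q * (q - 1)) • (1 : D) := by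
    rw [mul_smul, ← smul_add, ← h, smul_smul, mul_inv_cancel₀ hq, one_smul]
  rw [mul_add, ← mul_assoc, h1, ← Algebra.commutes, add_mul, add_mul, smul_mul_assoc,
    smul_mul_assoc, one_mul, smul_add, ← Algebra.smul_def, add_assoc, ← add_smul, smul_smul]
  congr 2
  ring

theorem conicGenY_mul_trace (hD : IsQDivisionRing k D q x y) (hq : q ≠ 0) :
    conicGenY q x y * (x - x⁻¹) =
      q⁻¹ • (conicGenX q x y * conicGenX q x y) - conicConst q x y * conicConst q x y := by
  have h := hD.conicGenX_mul_conicConst hq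
  have h1 := hD.mul_conicConj_expand hq
  rw [conicGenY]
  generalize conicGenX q x y = R at *
  generalize conicConst q x y = m at *
  rw [← smul_mul_assoc, h] at h1
  rw [← sub_eq_zero] at h1 ⊢
  rw [← h1, Algebra.algebraMap_eq_smul_one]
  simp only [sub_smul, one_smul, add_mul, sub_mul, mul_sub, smul_mul_assoc, one_mul]
  abel

theorem exists_algHom_range_eq_conic_fixed (hD : IsQDivisionRing k D q x y) (hq : q ≠ 0)
    {φ : D →ₐ[k] D} (hφx : φ x = -x⁻¹) (hφy : φ y = conicConj q x y) :
    ∃ F : D →ₐ[k] D, F x = conicGenX q x y ∧ F y = conicGenY q x y ∧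
      ∀ d, φ d = d ↔ ∃ e, F e = d := by
  have hx := hD.x_ne_zero
  have hy' := (hD.hasVal_conicConj hq).ne_zero hD
  have hs := (hD.hasVal_add_inv_x hq).ne_zero hD
  have hφxi : φ x⁻¹ = -x := by rw [map_inv₀, hφx, inv_neg, inv_inv]
  have hφy' : φ (conicConj q x y) = y := by
    apply mul_left_cancel₀ hy'
    rw [hD.conicConj_mul hq]
    nth_rw 2 [conicConj]
    rw [map_mul, map_inv₀, hφy, mul_inv_cancel_left₀ hy', map_sub,
      map_smul, hφxi, hφx, smul_neg, sub_neg_eq_add, neg_add_eq_sub]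
  have hφs : φ (x + x⁻¹) = -(x + x⁻¹) := by
    rw [map_add, hφx, hφxi]
    abel
  have hφR : φ (conicGenX q x y) = conicGenX q x y := by
    rw [conicGenX, map_mul, map_inv₀, hφs, map_sub, hφy, hφy', ← neg_sub y, inv_neg, neg_mul_neg]
  have hφm : φ (conicConst q x y) = conicConst q x y := by
    rw [conicConst, map_mul, map_inv₀, hφs, map_add, map_mul, map_mul, hφx, hφxi, hφy, hφy',
      inv_neg, mul_neg, mul_neg, mul_neg, ← neg_add, neg_mul, neg_neg, add_comm (_ * x)]
  refine hD.exists_algHom_range_eq_fixed (z := x) (hD.conicGenX_mul_conicGenY hq)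
    (linearIndependent_monomials_of_hasVal hD hq (hD.hasVal_conicGenX hq)
      (hD.hasVal_conicGenY hq) (by norm_num)) hφR ?_ ?_ ?_
  · rw [conicGenY, map_add, map_mul, hφR, hφm, AlgHom.commutes]
  · rw [hφx]
    intro h
    exact hs (by nth_rw 1 [← h]; exact neg_add_cancel _)
  · intro L hinv hR hP
    have hR0 := (hD.hasVal_conicGenX hq).ne_zero hD
    have hP0 := (hD.hasVal_conicGenY hq).ne_zero hD
    have hm : conicConst q x y ∈ L := by
      rw [← mul_inv_cancel_right₀ hR0 (conicConst q x y),
        ← add_sub_cancel_right (conicConst q x y * conicGenX q x y) (algebraMap k D q)]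
      exact mul_mem (sub_mem hP (L.algebraMap_mem q)) (hinv _ hR)
    have ht : x - x⁻¹ ∈ L := by
      rw [← inv_mul_cancel_left₀ hP0 (x - x⁻¹), hD.conicGenY_mul_trace hq]
      exact mul_mem (hinv _ hP) (sub_mem (L.smul_mem (mul_mem hR hR) _) (mul_mem hm hm))
    have h1 := hD.conicConst_add hq
    generalize conicGenX q x y = R at *
    generalize conicConst q x y = m at *
    have hxx : x * x = 1 + (x - x⁻¹) * x := by
      rw [sub_mul, inv_mul_cancel₀ hx]
      abel
    generalize x - x⁻¹ = t at *
    refine ⟨⟨0, zero_mem L, 1, one_mem L, by simp⟩, ⟨1, one_mem L, t, ht, hxx⟩,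
      ⟨m, hm, R, hR, h1.symm⟩, ⟨q • R, L.smul_mem hR _, q • (m + R * t),
        L.smul_mem (add_mem hm (mul_mem hR ht)) _, ?_⟩⟩
    rw [hD.mul_eq_smul, smul_mul_assoc, ← smul_add]
    congr 1
    rw [← h1, add_mul, mul_assoc, hxx]
    noncomm_ring

end Conic

theorem map_invGenX {ρ : D →ₐ[k] D}
    (hρx : ρ x = y⁻¹) (hρy : ρ y = x) : ρ (invGenX x y) = -(invGenX x y)⁻¹ := by
  rw [invGenX, map_mul, map_inv₀, map_sub, map_sub, map_inv₀, map_inv₀, hρx, hρy, inv_inv,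
    mul_inv_rev, inv_inv, ← neg_sub x, inv_neg, mul_neg]

theorem map_invGenY (hD : IsQDivisionRing k D q x y) (hq : q ≠ 0) {ρ : D →ₐ[k] D}
    (hρx : ρ x = y⁻¹) (hρy : ρ y = x) :
    ρ (invGenY x y) = conicConj q (invGenX x y) (invGenY x y) := by
  have hu := (hD.hasVal_invGenX hq).ne_zero hD
  have hv := (hD.hasVal_invGenY hq).ne_zero hD
  have h1 := congrArg ρ (hD.invGenX_mul_y_sub hq)
  have h2 := hD.invGenX_mul_y_inv_sub hq
  have h3 := hD.invGen_mul_trace hq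
  have huv := hD.invGenX_mul_invGenY hq
  rw [map_sub, map_mul, map_invGenX hρx hρy, map_inv₀, hρx, hρy, inv_inv] at h1
  rw [conicConj]
  generalize invGenX x y = u at *
  generalize invGenY x y = v at *
  generalize ρ v = w at *
  have h4 : u * w = v - u * (y + y⁻¹) := by
    have h5 : w = -u⁻¹ * x - y := by rw [← h1, sub_sub_cancel]
    rw [h5, mul_sub, neg_mul, mul_neg, mul_inv_cancel_left₀ hu, ← h2]
    noncomm_ring
  apply mul_left_cancel₀ (mul_ne_zero hv hu)
  have h6 : v * u * (v⁻¹ * (q • u⁻¹ - u)) = 1 - q⁻¹ • (u * u) := by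
    have h7 : v * u = q⁻¹ • (u * v) := by
      rw [huv, smul_smul, inv_mul_cancel₀ hq, one_smul]
    rw [h7, smul_mul_assoc, mul_assoc, mul_inv_cancel_left₀ hv, mul_sub, mul_smul_comm,
      mul_inv_cancel₀ hu, smul_sub, smul_smul, inv_mul_cancel₀ hq, one_smul]
  rw [h6, mul_assoc, h4, mul_sub, ← mul_assoc, h3]
  abel

end FixedRing

end IsQDivisionRing

/-- Let `ρ` be the order-4 `k`-algebra automorphism of `D` with `ρ(x) = y⁻¹`, `ρ(y) = x`.
Then the fixed ring `D^ρ = {r ∈ D : ρ(r) = r}` is isomorphic to `D = k_q(x,y)` as a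
`k`-algebra (for the same `q`): there is an injective `k`-algebra endomorphism of `D`
whose range is exactly `D^ρ`. -/
theorem stmt7 (k : Type*) [Field k] [CharZero k] (q : k) (hq : q ≠ 0)
    (D : Type*) [DivisionRing D] [Algebra k D] (x y : D)
    (hD : IsQDivisionRing k D q x y)
    (ρ : D ≃ₐ[k] D) (hρx : ρ x = y⁻¹) (hρy : ρ y = x) :
    ∃ F : D →ₐ[k] D, Function.Injective F ∧
      Set.range F = {r : D | ρ r = r} := by
  obtain ⟨F, hFx, hFy, hF⟩ := hD.exists_algHom_range_eq_inversion_fixed hq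
    (τ := (ρ : D →ₐ[k] D).comp (ρ : D →ₐ[k] D)) (by simp [hρx, hρy]) (by simp [hρx, hρy])
  replace hF : ∀ d, ρ (ρ d) = d ↔ ∃ e, F e = d := hF
  have hFinj : Function.Injective F := F.toRingHom.injective
  have hρF : ∀ d, ((ρ : D →ₐ[k] D).comp F) d ∈ F.range := fun d => by
    obtain ⟨e, he⟩ := (hF (ρ (F d))).1 (congrArg ρ ((hF (F d)).2 ⟨d, rfl⟩))
    exact ⟨e, he⟩
  let φ : D →ₐ[k] D := ((AlgEquiv.ofInjective F hFinj).symm : F.range →ₐ[k] D).comp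
    (((ρ : D →ₐ[k] D).comp F).codRestrict F.range hρF)
  have hφ : ∀ d, F (φ d) = ρ (F d) := fun d =>
    congrArg Subtype.val ((AlgEquiv.ofInjective F hFinj).apply_symm_apply
      (((ρ : D →ₐ[k] D).comp F).codRestrict F.range hρF d))
  obtain ⟨G, -, -, hG⟩ := hD.exists_algHom_range_eq_conic_fixed hq (φ := φ)
    (hFinj (by
      rw [hφ, hFx, map_neg, map_inv₀, hFx]
      exact IsQDivisionRing.map_invGenX (ρ := (ρ : D →ₐ[k] D)) hρx hρy))
    (hFinj (by
      rw [hφ, IsQDivisionRing.conicConj, map_mul, map_inv₀, map_sub, map_smul, map_inv₀, hFx, hFy]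
      exact hD.map_invGenY hq (ρ := (ρ : D →ₐ[k] D)) hρx hρy))
  refine ⟨F.comp G, (F.comp G).toRingHom.injective, ?_⟩
  ext r
  simp only [Set.mem_range, Set.mem_ofPred_eq, AlgHom.comp_apply]
  constructor
  · rintro ⟨e, rfl⟩
    rw [← hφ, (hG (G e)).2 ⟨e, rfl⟩]
  · intro hr
    obtain ⟨d, rfl⟩ := (hF r).1 (by rw [hr, hr])
    obtain ⟨e, rfl⟩ := (hG d).1 (hFinj (by rw [hφ, hr]))
    exact ⟨e, rfl⟩
end

section
/- The automorphism ρ acts on the elements u and v by ρ(u) = −u⁻¹ and ρ(v) = (u⁻¹ − qu)v⁻¹. -/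
/-- The product formula behind `ρ v * v = u⁻¹ - q u`, valid for any `q`-commuting `x`, `y`. -/
theorem qCommuting_product_formula {k D : Type*} [Field k] [DivisionRing D] [Algebra k D]
    {q : k} {x y : D} (hx : x ≠ 0) (hy : y ≠ 0) (hrel : x * y = q • (y * x))
    (ha : x - x⁻¹ ≠ 0) :
    -((y⁻¹ * x - y * x⁻¹) * (x - x⁻¹)⁻¹ * (x * y - x⁻¹ * y⁻¹)) =
      (y⁻¹ - y) * (x - x⁻¹)⁻¹ * (y⁻¹ - y) - q • (x - x⁻¹) := by
  have hxy : y⁻¹ * x * y = q • x := by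
    rw [mul_assoc, hrel, mul_smul_comm, inv_mul_cancel_left₀ hy]
  have hxy' : q • (x⁻¹ * y) = y * x⁻¹ := by
    rw [← mul_right_inj' hx, ← mul_left_inj' hx]
    simp [mul_assoc, hx, hrel]
  have hxinvy : q • (y⁻¹ * x⁻¹ * y) = x⁻¹ := by
    rw [mul_assoc, ← mul_smul_comm, hxy', inv_mul_cancel_left₀ hy]
  have hxyinv : q • (x * y⁻¹) = y⁻¹ * x := by
    rw [← mul_right_inj' hy, ← mul_left_inj' hy]
    simp [mul_assoc, hy, hrel]
  have hyx : q • (y * x * y⁻¹) = x := by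
    rw [mul_assoc, ← mul_smul_comm, hxyinv, mul_inv_cancel_left₀ hy]
  have hinv : x⁻¹ * y⁻¹ = q • (y⁻¹ * x⁻¹) := by
    rw [← mul_right_inj' hy, ← mul_left_inj' hy]
    simp only [mul_assoc, inv_mul_cancel₀ hy, mul_smul_comm, smul_mul_assoc,
      mul_inv_cancel_left₀ hy, mul_one, hxy']
  have hyxinv : y * x⁻¹ * y⁻¹ = q • x⁻¹ := by
    rw [mul_assoc, hinv, mul_smul_comm, mul_inv_cancel_left₀ hy]
  set a := x - x⁻¹ with ha_def
  have hax : a⁻¹ * x = x * a⁻¹ := by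
    have : Commute a x := by
      rw [ha_def]
      exact (Commute.refl x).sub_left (Commute.refl x).inv_left₀
    exact this.inv_left₀
  obtain ⟨F, hF⟩ : ∃ F, F = y⁻¹ * a⁻¹ * y := ⟨_, rfl⟩
  obtain ⟨G, hG⟩ : ∃ G, G = y * a⁻¹ * y⁻¹ := ⟨_, rfl⟩
  have hay : a⁻¹ * y = y * F := by simp [hF, mul_assoc, hy]
  have hayinv : a⁻¹ * y⁻¹ = y⁻¹ * G := by simp [hG, mul_assoc, hy]
  -- `F` and `G` are the conjugates of `a⁻¹`, that is `a⁻¹` with `x` scaled by `q` and `q⁻¹`.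
  have hF_inv : (q * q) • (x * F * x) = F + q • x := by
    have hcore : x * a⁻¹ * x = a⁻¹ + x := by
      have hxx : x * x = a * x + 1 := by simp [ha_def, sub_mul, hx]
      rw [← hax, mul_assoc, hxx, mul_add, inv_mul_cancel_left₀ ha, mul_one, add_comm]
    calc (q * q) • (x * F * x) = (q • x) * F * (q • x) := by
          simp only [smul_mul_assoc, mul_smul_comm, smul_smul]
      _ = y⁻¹ * (x * a⁻¹ * x) * y := by
          rw [← hxy, hF]
          simp only [mul_assoc, mul_inv_cancel_left₀ hy]
      _ = F + q • x := by rw [hcore, mul_add, add_mul, hxy, hF]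
  have hG_inv : (q * q) • (x⁻¹ * G * x⁻¹) = G - q • x⁻¹ := by
    have hcore : x⁻¹ * a⁻¹ * x⁻¹ = a⁻¹ - x⁻¹ := by
      have hxx : x⁻¹ * x⁻¹ = 1 - a * x⁻¹ := by simp [ha_def, sub_mul, hx]
      have hax' : a⁻¹ * x⁻¹ = x⁻¹ * a⁻¹ := Commute.inv_right₀ hax
      rw [← hax', mul_assoc, hxx, mul_sub, inv_mul_cancel_left₀ ha, mul_one]
    calc (q * q) • (x⁻¹ * G * x⁻¹) = (q • x⁻¹) * G * (q • x⁻¹) := by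
          simp only [smul_mul_assoc, mul_smul_comm, smul_smul]
      _ = y * (x⁻¹ * a⁻¹ * x⁻¹) * y⁻¹ := by
          rw [← hyxinv, hG]
          simp only [mul_assoc, inv_mul_cancel_left₀ hy]
      _ = G - q • x⁻¹ := by rw [hcore, mul_sub, sub_mul, hyxinv, hG]
  have h₁ : y⁻¹ * x * (y * F * x) = q • (x * F * x) := by
    rw [← smul_mul_assoc, ← smul_mul_assoc, ← hxy]; simp only [mul_assoc]
  have h₂ : q • (y⁻¹ * x * (y⁻¹ * G * x⁻¹)) = y⁻¹ * y⁻¹ * G := by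
    have hGx : Commute G x := by
      rw [← hyx, hG]
      refine Commute.smul_right ?_ q
      simp only [commute_iff_eq, mul_assoc, inv_mul_cancel_left₀ hy]
      rw [← mul_assoc a⁻¹, hax, mul_assoc]
    rw [mul_assoc y⁻¹ x, mul_assoc y⁻¹ G, ← mul_assoc x, ← mul_smul_comm, ← smul_mul_assoc,
      hxyinv, hGx.inv_right₀.eq]
    simp only [mul_assoc, mul_inv_cancel_left₀ hx]
  have h₃ : q • (y * x⁻¹ * (y * F * x)) = y * y * F := by
    have hFx : Commute F x⁻¹ := by
      rw [← hxinvy, hF]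
      refine Commute.smul_right ?_ q
      have hax' : a⁻¹ * x⁻¹ = x⁻¹ * a⁻¹ := Commute.inv_right₀ hax
      simp only [commute_iff_eq, mul_assoc, mul_inv_cancel_left₀ hy]
      rw [← mul_assoc a⁻¹, hax', mul_assoc]
    rw [mul_assoc y x⁻¹, mul_assoc y F, ← mul_assoc x⁻¹, ← mul_smul_comm, ← smul_mul_assoc,
      hxy', mul_assoc y x⁻¹, ← mul_assoc x⁻¹, ← hFx.eq, inv_mul_cancel_right₀ hx, mul_assoc]
  have h₄ : y * x⁻¹ * (y⁻¹ * G * x⁻¹) = q • (x⁻¹ * G * x⁻¹) := by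
    rw [← smul_mul_assoc, ← smul_mul_assoc, ← hyxinv]; simp only [mul_assoc]
  calc -((y⁻¹ * x - y * x⁻¹) * a⁻¹ * (x * y - x⁻¹ * y⁻¹))
      = -((y⁻¹ * x - y * x⁻¹) * (q • (a⁻¹ * y * x - a⁻¹ * y⁻¹ * x⁻¹))) := by
        rw [hrel, hinv, ← smul_sub]
        simp only [mul_smul_comm, mul_assoc, mul_sub]
    _ = q • (y⁻¹ * x * (y⁻¹ * G * x⁻¹)) + q • (y * x⁻¹ * (y * F * x))
          - q • (y⁻¹ * x * (y * F * x)) - q • (y * x⁻¹ * (y⁻¹ * G * x⁻¹)) := by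
        rw [hay, hayinv]
        simp only [sub_mul, mul_sub, smul_sub, mul_smul_comm]
        abel
    _ = y⁻¹ * y⁻¹ * G + y * y * F - (F + q • x) - (G - q • x⁻¹) := by
        rw [h₁, h₂, h₃, h₄, smul_smul, smul_smul, hF_inv, hG_inv]
    _ = (y⁻¹ - y) * (a⁻¹ * y⁻¹ - a⁻¹ * y) - q • a := by
        rw [hay, hayinv, ha_def]
        simp only [sub_mul, mul_sub, smul_sub, ← mul_assoc, inv_mul_cancel₀ hy,
          mul_inv_cancel₀ hy, one_mul]
        abel
    _ = (y⁻¹ - y) * a⁻¹ * (y⁻¹ - y) - q • a := by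
        simp only [mul_assoc, mul_sub]

/-- The order-4 automorphism `ρ` (with `ρ(x) = y⁻¹`, `ρ(y) = x`) acts on the `q`-commuting
generators `u = (x − x⁻¹)(y⁻¹ − y)⁻¹`, `v = (xy − x⁻¹y⁻¹)(y⁻¹ − y)⁻¹` of the fixed ring
`D^τ` (where `τ = ρ²`) by `ρ(u) = −u⁻¹` and `ρ(v) = (u⁻¹ − qu)v⁻¹`. -/
theorem stmt8 (k : Type*) [Field k] [CharZero k] (q : k) (hq : q ≠ 0)
    (D : Type*) [DivisionRing D] [Algebra k D] (x y : D)
    (hD : IsQDivisionRing k D q x y)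
    (ρ : D ≃ₐ[k] D) (hρx : ρ x = y⁻¹) (hρy : ρ y = x) :
    let Q : D := algebraMap k D q
    let u : D := (x - x⁻¹) * (y⁻¹ - y)⁻¹
    let v : D := (x * y - x⁻¹ * y⁻¹) * (y⁻¹ - y)⁻¹
    ρ u = -u⁻¹ ∧ ρ v = (u⁻¹ - Q * u) * v⁻¹ := by
  intro Q u v
  have hx := hD.x_ne_zero
  have hy := hD.y_ne_zero
  have hrel : x * y = q • (y * x) := by rw [hD.rel, Algebra.smul_def]
  have hmon : ∀ i j : ℕ, (i, j) ≠ (0, 0) → y ^ i * x ^ j ≠ 1 := fun i j hij h =>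
    hij (hD.monomials_linearIndependent.injective (by simpa using h))
  have ha : x - x⁻¹ ≠ 0 := fun h => hmon 0 2 (by simp) <| by
    rw [pow_zero, one_mul, sq]
    nth_rewrite 2 [sub_eq_zero.mp h]
    exact mul_inv_cancel₀ hx
  have hb : y⁻¹ - y ≠ 0 := fun h => hmon 2 0 (by simp) <| by
    rw [pow_zero, mul_one, sq]
    nth_rewrite 2 [← sub_eq_zero.mp h]
    exact mul_inv_cancel₀ hy
  have hw : x * y - x⁻¹ * y⁻¹ ≠ 0 := fun h => hmon 2 2 (by simp) <| by
    rw [mul_eq_one_comm, sq, sq, mul_assoc, ← mul_assoc x y, sub_eq_zero.mp h]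
    simp [hx, hy]
  have hformula := qCommuting_product_formula hx hy hrel ha
  have hneg : x⁻¹ - x = -(x - x⁻¹) := (neg_sub _ _).symm
  refine ⟨?_, ?_⟩
  · simp only [u, map_mul, map_sub, map_inv₀, hρx, hρy, inv_inv, mul_inv_rev]
    rw [hneg, inv_neg, mul_neg]
  · have hv : v ≠ 0 := mul_ne_zero hw (inv_ne_zero hb)
    rw [eq_mul_inv_iff_mul_eq₀ hv]
    simp only [u, v, Q, map_mul, map_sub, map_inv₀, hρx, hρy, inv_inv, mul_inv_rev]
    rw [← mul_assoc, mul_inv_eq_iff_eq_mul₀ hb, hneg, inv_neg, mul_neg, neg_mul, hformula,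
      sub_mul _ _ (y⁻¹ - y), mul_assoc (algebraMap k D q), inv_mul_cancel_right₀ hb,
      Algebra.smul_def]
end

section
/- The elements f and g of D are fixed by σ (σ(f) = f and σ(g) = g) and satisfy fg = qgf. -/
/-- For a cyclic `q`-commuting triple, the first two Fourier components have commutator
proportional to the second Fourier component of the complementary triple. -/
theorem sum_mul_eigen_sub_eigen_mul_sum {k D : Type*} [Field k] [Ring D] [Algebra k D] {ω h : k}
    (hω : ω ^ 2 + ω + 1 = 0) {x y z x' y' z' : D}
    (hxy : x * y = h • z') (hyx : y * x = h⁻¹ • z') (hyz : y * z = h • x')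
    (hzy : z * y = h⁻¹ • x') (hzx : z * x = h • y') (hxz : x * z = h⁻¹ • y') :
    (x + y + z) * (x + ω • y + ω ^ 2 • z) =
      (x + ω • y + ω ^ 2 • z) * (x + y + z) +
        ((ω ^ 2 - ω) * (h - h⁻¹)) • (x' + ω • y' + ω ^ 2 • z') := by
  have hω3 : ω ^ 3 = 1 := by linear_combination (ω - 1) * hω
  simp only [mul_add, add_mul, mul_smul_comm, smul_mul_assoc, hxy, hyx, hyz, hzy, hzx, hxz]
  match_scalars <;> first
    | ring1
    | linear_combination (h⁻¹ - h) * hω3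
    | linear_combination ((1 - ω) * (h - h⁻¹)) * hω3

/-- The `q`-commutation relation extracted from the relations between `g`, the invariants `s`, `t`
and the two mixed components `p`, `r`. -/
theorem qComm_of_mixed_relations {k D : Type*} [Field k] [DivisionRing D] [Algebra k D]
    {ω h : k} (hω : ω ^ 2 + ω + 1 = 0) (hω1 : ω ≠ 1) (hh : h ≠ 0) {s t g p r : D} (hg : g ≠ 0)
    (hs : s = p + ω • r)
    (htg : (t + ((ω ^ 2 - ω) * (h - h⁻¹)) • g) * g = ω • p + r)
    (hgt : g * t = (h ^ 2 * ω) • p + (h ^ 2)⁻¹ • r)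
    (hsg : (h ^ 2 • p + (ω * (h ^ 2)⁻¹) • r) * g = g * s + ((ω ^ 2 - ω) * (h - h⁻¹)) • (1 : D)) :
    (s - ω ^ 2 • (t * g) + ((ω ^ 2 - ω) * h⁻¹) • (ω ^ 2 • g ^ 2 + h ^ 2 • g⁻¹)) * g =
      h ^ 2 • (g * (s - ω ^ 2 • (t * g) +
        ((ω ^ 2 - ω) * h⁻¹) • (ω ^ 2 • g ^ 2 + h ^ 2 • g⁻¹))) := by
  have hω3 : ω ^ 3 = 1 := by linear_combination (ω - 1) * hω
  set δ : k := (ω ^ 2 - ω) * (h - h⁻¹) with hδ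
  have htg' : t * g = ω • p + r - δ • g ^ 2 := by
    rw [← htg, add_mul, smul_mul_assoc, ← sq]; abel
  have hcube : g * (ω • p + r) - ((h ^ 2 * ω) • p + (h ^ 2)⁻¹ • r) * g = δ • g ^ 3 := by
    rw [← htg, ← hgt, pow_succ', sq]
    simp only [mul_add, add_mul, mul_smul_comm, smul_mul_assoc, mul_assoc]
    abel
  have hr : (1 - ω ^ 2) • (g * r - (h ^ 2)⁻¹ • (r * g)) = δ • (g ^ 3 + ω • (1 : D)) := by
    rw [smul_add, ← hcube]
    have : δ • ω • (1 : D) =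
        ω • ((h ^ 2 • p + (ω * (h ^ 2)⁻¹) • r) * g) - ω • (g * (p + ω • r)) := by
      rw [hsg, hs]; module
    rw [this]
    simp only [mul_add, add_mul, mul_smul_comm, smul_mul_assoc]
    module
  have hω2 : 1 - ω ^ 2 ≠ 0 := by
    intro h0
    have : (1 - ω) * (1 + ω) = 0 := by linear_combination h0
    rcases mul_eq_zero.mp this with h1 | h1
    · exact hω1 (by linear_combination -h1)
    · exact one_ne_zero (α := k) (by linear_combination h0 + hω - h1)
  have hrg : r * g = h ^ 2 • (g * r) + (h * (1 - h ^ 2)) • (ω ^ 2 • g ^ 3 + (1 : D)) := by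
    apply smul_right_injective D hω2
    linear_combination (norm := skip) (-(h ^ 2)) • hr
    simp only [hδ]
    match_scalars <;> field_simp <;> ring_nf
    · linear_combination (h * ω - h ^ 3 * ω) * hω3
    · linear_combination (h - h ^ 3) * hω3
  rw [hs, htg']
  simp only [mul_add, add_mul, mul_sub, sub_mul, mul_smul_comm, smul_mul_assoc, smul_add, smul_sub,
    inv_mul_cancel₀ hg, mul_inv_cancel₀ hg, hrg, ← pow_succ, ← pow_succ']
  simp only [hδ]
  match_scalars <;> field_simp <;> ring_nf
  · linear_combination -hω3
  · linear_combination h ^ 2 * hω3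

/-- Suppose `k` contains a primitive third root of unity `ω` and a square root `q̂` of `q`, and
let `σ` be the order-3 automorphism of `D` with `σ(x) = y`, `σ(y) = q̂y⁻¹x⁻¹`.  The elements
`f` and `g` of `D` are fixed by `σ` and satisfy `fg = qgf`. -/
theorem stmt9 (k : Type*) [Field k] [CharZero k] (q : k) (hq : q ≠ 0)
    (ω : k) (hω : IsPrimitiveRoot ω 3) (qh : k) (hqh : qh ^ 2 = q)
    (D : Type*) [DivisionRing D] [Algebra k D] (x y : D)
    (hD : IsQDivisionRing k D q x y)
    (σ : D ≃ₐ[k] D) (hσx : σ x = y)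
    (hσy : σ y = algebraMap k D qh * (y⁻¹ * x⁻¹)) :
    let Q : D := algebraMap k D q
    let Qh : D := algebraMap k D qh
    let W : D := algebraMap k D ω
    let θ₁ : D := x + y + Qh * (y⁻¹ * x⁻¹)
    let θ₂ : D := x⁻¹ + y⁻¹ + Qh * (y * x)
    let a : D := x + W * y + W ^ 2 * (Qh * (y⁻¹ * x⁻¹))
    let b : D := x⁻¹ + W * y⁻¹ + W ^ 2 * (Qh * (y * x))
    let g : D := a⁻¹ * b
    let f : D := θ₂ - W ^ 2 * (θ₁ * g) + (W ^ 2 - W) * Qh⁻¹ * (W ^ 2 * g ^ 2 + Qh ^ 2 * g⁻¹)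
    σ f = f ∧ σ g = g ∧ f * g = Q * (g * f) := by
  intro Q Qh W θ₁ θ₂ a b g f
  obtain ⟨hx, hy, hrel, -, -⟩ := hD
  have hh : qh ≠ 0 := by rintro rfl; exact hq (by rw [← hqh]; simp)
  have hω1 : ω ≠ 1 := hω.ne_one (by norm_num)
  have hω0 : ω ≠ 0 := hω.ne_zero (by norm_num)
  have hω3 : ω ^ 3 = 1 := hω.pow_eq_one
  have hωs : ω ^ 2 + ω + 1 = 0 := by
    refine (mul_eq_zero.mp (?_ : (ω - 1) * (ω ^ 2 + ω + 1) = 0)).resolve_left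
      (sub_ne_zero.mpr hω1)
    linear_combination hω3
  have hrel' : x * y = qh ^ 2 • (y * x) := by rw [hrel, hqh, Algebra.smul_def]
  obtain ⟨z, hz⟩ : ∃ z, z = Qh * (y⁻¹ * x⁻¹) := ⟨_, rfl⟩
  obtain ⟨z', hz'⟩ : ∃ z', z' = Qh * (y * x) := ⟨_, rfl⟩
  have hzs : z = qh • (y⁻¹ * x⁻¹) := by rw [hz, Algebra.smul_def]
  have hzs' : z' = qh • (y * x) := by rw [hz', Algebra.smul_def]
  have hxy : x * y = qh • z' := by rw [hrel', hzs']; module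
  have hyx : y * x = qh⁻¹ • z' := by rw [hzs', inv_smul_smul₀ hh]
  have hzz : z' = z⁻¹ := by
    rw [hzs, smul_inv₀, mul_inv_rev, inv_inv, inv_inv, hxy, inv_smul_smul₀ hh]
  have hσyz : σ y = z := by rw [hσy, hz]
  have hσz : σ z = x := by
    rw [hzs, map_smul, map_mul, map_inv₀, map_inv₀, hσyz, hσx, ← hzz, hzs', smul_mul_assoc,
      smul_smul, ← sq, ← smul_mul_assoc, ← hrel', mul_inv_cancel_right₀ hy]
  have hσx' : σ x⁻¹ = y⁻¹ := by rw [map_inv₀, hσx]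
  have hσy' : σ y⁻¹ = z' := by rw [map_inv₀, hσyz, hzz]
  have hσz' : σ z' = x⁻¹ := by rw [hzz, map_inv₀, hσz]
  have hyz : y * z = qh • x⁻¹ := by simpa [hσx, hσyz, hσz', -map_inv₀] using congrArg σ hxy
  have hzy : z * y = qh⁻¹ • x⁻¹ := by simpa [hσx, hσyz, hσz', -map_inv₀] using congrArg σ hyx
  have hzx : z * x = qh • y⁻¹ := by
    simpa [hσx, hσyz, hσz, hσx', -map_inv₀] using congrArg σ hyz
  have hxz : x * z = qh⁻¹ • y⁻¹ := by
    simpa [hσx, hσyz, hσz, hσx', -map_inv₀] using congrArg σ hzy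
  have hxyi : x⁻¹ * y⁻¹ = qh • z := by
    rw [← mul_inv_rev, hyx, smul_inv₀, inv_inv, hzz, inv_inv]
  have hyxi : y⁻¹ * x⁻¹ = qh⁻¹ • z := by rw [hzs, inv_smul_smul₀ hh]
  have hyzi : y⁻¹ * z' = qh • x := by
    simpa [hσx', hσy', hσz, -map_inv₀] using congrArg σ hxyi
  have hzyi : z' * y⁻¹ = qh⁻¹ • x := by
    simpa [hσx', hσy', hσz, -map_inv₀] using congrArg σ hyxi
  have hzxi : z' * x⁻¹ = qh • y := by
    simpa [hσx', hσy', hσz', hσx, -map_inv₀] using congrArg σ hyzi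
  have hxzi : x⁻¹ * z' = qh⁻¹ • y := by
    simpa [hσx', hσy', hσz', hσx, -map_inv₀] using congrArg σ hzyi
  have hyix : y⁻¹ * x = qh ^ 2 • (x * y⁻¹) := by
    rw [inv_mul_eq_iff_eq_mul₀ hy, mul_smul_comm, ← mul_assoc, ← smul_mul_assoc, ← hrel',
      mul_inv_cancel_right₀ hy]
  have hziy : z' * y = qh ^ 2 • (y * z') := by
    simpa [hσx, hσyz, hσy', -map_inv₀] using congrArg σ hyix
  have hxiz : x⁻¹ * z = qh ^ 2 • (z * x⁻¹) := by
    simpa [hσyz, hσz', -map_inv₀] using congrArg σ hziy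
  have hxiy : x⁻¹ * y = (qh ^ 2)⁻¹ • (y * x⁻¹) := by
    rw [inv_mul_eq_iff_eq_mul₀ hx, mul_smul_comm, ← mul_assoc, hrel', smul_mul_assoc,
      mul_inv_cancel_right₀ hx, inv_smul_smul₀ (pow_ne_zero 2 hh)]
  have hyiz : y⁻¹ * z = (qh ^ 2)⁻¹ • (z * y⁻¹) := by
    simpa [hσx, hσyz, hσx', hσy', -map_inv₀] using congrArg σ hxiy
  have hzix : z' * x = (qh ^ 2)⁻¹ • (x * z') := by
    simpa [hσz, hσy', -map_inv₀] using congrArg σ hyiz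
  have hz0 : z ≠ 0 := by rw [← hσyz]; exact (map_ne_zero σ).mpr hy
  have hzz1 : z * z' = 1 := by rw [hzz, mul_inv_cancel₀ hz0]
  have hzz2 : z' * z = 1 := by rw [hzz, inv_mul_cancel₀ hz0]
  have hW2 : W ^ 2 = algebraMap k D (ω ^ 2) := (map_pow _ _ _).symm
  have ht : θ₁ = x + y + z := by rw [hz]
  have hs : θ₂ = x⁻¹ + y⁻¹ + z' := by rw [hz']
  have ha : a = x + ω • y + ω ^ 2 • z := by
    simp only [a, ← hz, hW2, W, Algebra.smul_def]
  have hb : b = x⁻¹ + ω • y⁻¹ + ω ^ 2 • z' := by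
    simp only [b, ← hz', hW2, W, Algebra.smul_def]
  have hg : g = a⁻¹ * b := rfl
  have hf : f = θ₂ - ω ^ 2 • (θ₁ * g) +
      ((ω ^ 2 - ω) * qh⁻¹) • (ω ^ 2 • g ^ 2 + qh ^ 2 • g⁻¹) := by
    simp only [f, W, Qh, Algebra.smul_def, map_mul, map_sub, map_pow, map_inv₀]
  have hta := sum_mul_eigen_sub_eigen_mul_sum hωs hxy hyx hyz hzy hzx hxz
  have hsb := sum_mul_eigen_sub_eigen_mul_sum hωs hxyi hyxi hyzi hzyi hzxi hxzi
  rw [← ht, ← ha, ← hb] at hta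
  rw [← hs, ← ha, ← hb] at hsb
  have hσθ₁ : σ θ₁ = θ₁ := by rw [ht]; simp only [map_add, hσx, hσyz, hσz]; abel
  have hσθ₂ : σ θ₂ = θ₂ := by rw [hs]; simp only [map_add, hσx', hσy', hσz']; abel
  have hσa : σ a = ω ^ 2 • a := by
    rw [ha]; simp only [map_add, map_smul, hσx, hσyz, hσz]
    match_scalars <;> first | ring1 | linear_combination -hω3 | linear_combination (-ω) * hω3
  have hσb : σ b = ω ^ 2 • b := by
    rw [hb]; simp only [map_add, map_smul, hσx', hσy', hσz']
    match_scalars <;> first | ring1 | linear_combination -hω3 | linear_combination (-ω) * hω3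
  have hσg : σ g = g := by
    rw [hg, map_mul, map_inv₀, hσa, hσb, smul_inv₀, smul_mul_smul_comm,
      inv_mul_cancel₀ (pow_ne_zero 2 hω0), one_smul]
  refine ⟨?_, hσg, ?_⟩
  · simp only [hf, map_add, map_sub, map_mul, map_smul, map_pow, map_inv₀, hσg, hσθ₁, hσθ₂]
  have hQ (d : D) : Q * d = qh ^ 2 • d := by rw [hqh, Algebra.smul_def]
  rw [hQ]
  by_cases hg0 : g = 0
  · simp [hg0]
  have ha0 : a ≠ 0 := by rintro h; exact hg0 (by rw [hg, h]; simp)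
  have hag : a * g = b := by rw [hg, mul_inv_cancel_left₀ ha0]
  obtain ⟨P, hP⟩ : ∃ P, P = x * y⁻¹ + ω • (y * z') + ω ^ 2 • (z * x⁻¹) := ⟨_, rfl⟩
  obtain ⟨R, hR⟩ : ∃ R, R = y * x⁻¹ + ω • (z * y⁻¹) + ω ^ 2 • (x * z') := ⟨_, rfl⟩
  have has : a * θ₂ = P + ω • R := by
    rw [ha, hs, hP, hR]
    simp only [mul_add, add_mul, smul_mul_assoc, mul_inv_cancel₀ hx,
      mul_inv_cancel₀ hy, hzz1]
    match_scalars <;> first | ring1 | linear_combination hωs | linear_combination -hω3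
  have hsa : θ₂ * a = qh ^ 2 • P + (ω * (qh ^ 2)⁻¹) • R := by
    rw [ha, hs, hP, hR]
    simp only [mul_add, add_mul, mul_smul_comm, inv_mul_cancel₀ hx,
      inv_mul_cancel₀ hy, hzz2, hyix, hziy, hxiz, hxiy, hyiz, hzix]
    match_scalars <;> first
      | ring1 | linear_combination hωs | linear_combination (-(qh ^ 2)⁻¹) * hω3
  have htb : θ₁ * b = ω • P + R := by
    rw [hb, ht, hP, hR]
    simp only [mul_add, add_mul, mul_smul_comm, mul_inv_cancel₀ hx,
      mul_inv_cancel₀ hy, hzz1]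
    match_scalars <;> first | ring1 | linear_combination hωs | linear_combination -hω3
  have hbt : b * θ₁ = (qh ^ 2 * ω) • P + (qh ^ 2)⁻¹ • R := by
    rw [hb, ht, hP, hR]
    simp only [mul_add, add_mul, smul_mul_assoc, inv_mul_cancel₀ hx,
      inv_mul_cancel₀ hy, hzz2, hyix, hziy, hxiz, hxiy, hyiz, hzix]
    match_scalars <;> first
      | ring1 | linear_combination hωs | linear_combination (-qh ^ 2) * hω3
  rw [hf]
  refine qComm_of_mixed_relations (p := a⁻¹ * P) (r := a⁻¹ * R) hωs hω1 hh hg0 ?_ ?_ ?_ ?_ <;>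
    refine mul_left_cancel₀ ha0 ?_
  · simp only [mul_add, mul_smul_comm, mul_inv_cancel_left₀ ha0, has]
  · rw [← mul_assoc, mul_add, mul_smul_comm, hag, ← hta, mul_assoc, hag, htb]
    simp only [mul_add, mul_smul_comm, mul_inv_cancel_left₀ ha0]
  · rw [← mul_assoc, hag, hbt]
    simp only [mul_add, mul_smul_comm, mul_inv_cancel_left₀ ha0]
  · rw [← mul_assoc]
    simp only [mul_add, mul_smul_comm, mul_inv_cancel_left₀ ha0, ← hsa, mul_one]
    rw [← mul_assoc a, mul_assoc, hag, hsb]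
end
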